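/- arXiv:2403.20265 — 2 statements merged into one kernel-verified Lean document; each statement's English description precedes it below -/
import Mathlib

section
/- For every positive integer n there exists a constant M ≥ 1 with the following property. Let A ∈ ℝ^{2n×2n} with A ∉ L and rank A = 1, let Ω ⊂ ℝ^{2n} = ℝ^n × ℝ^n be a regular domain, and let α ∈ [0,1). Then there exists a sequence of maps u^{(j)} : closure(Ω) → ℝ^{2n} with u^{(j)} ∈ W^{1,1}(Ω;ℝ^{2n}) ∩ C^α(closure(Ω);ℝ^{2n}) and u^{(j)} = l_A on ∂Ω such that: (i) |{x ∈ Ω : |∇u^{(j)}(x)| > t}| ≤ M(1+|A|^{2n})|Ω| t^{−2n} for all t > 0 and all j; (ii) for every s ∈ [1,∞), ∫_{{x ∈ Ω : ∇u^{(j)}(x) ∉ L ∩ Σ}} (1+|∇u^{(j)}|^s) dx → 0 as j → ∞; (iii) u^{(j)} → l_A in C^α(closure(Ω)); (iv) u^{(j)} converges weakly to l_A in W^{1,p}(Ω) for every p ∈ [1,2n); and (v) liminf_{j→∞} ∫_Ω dist(∇u^{(j)}(x), L_i) dx > 0 for both i = 1 and i = 2. -/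
open MeasureTheory Set Filter Topology

noncomputable section

namespace Paper

variable {ι κ : Type*}

/-- Frobenius (Hilbert–Schmidt) norm of a matrix. -/
def frobNorm [Fintype ι] [Fintype κ] (A : Matrix κ ι ℝ) : ℝ :=
  Real.sqrt (∑ k, ∑ i, (A k i) ^ 2)

/-- Frobenius distance from a matrix to a set of matrices. -/
def frobDist [Fintype ι] [Fintype κ] (X : Matrix κ ι ℝ) (S : Set (Matrix κ ι ℝ)) : ℝ :=
  sInf ((fun Y => frobNorm (X - Y)) '' S)

/-- The affine map `x ↦ A x + b`. -/
def lmap [Fintype ι] (A : Matrix κ ι ℝ) (b : κ → ℝ) (x : ι → ℝ) : κ → ℝ :=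
  fun k => (∑ i, A k i * x i) + b k

/-- A regular domain: open, bounded, connected, with Lebesgue-null boundary. -/
def IsRegularDomain [Fintype ι] (Ω : Set (ι → ℝ)) : Prop :=
  IsOpen Ω ∧ Bornology.IsBounded Ω ∧ IsConnected Ω ∧ volume (frontier Ω) = 0

/-- `u` agrees with an affine map on `S`. -/
def IsAffineOn [Fintype ι] (u : (ι → ℝ) → κ → ℝ) (S : Set (ι → ℝ)) : Prop :=
  ∃ (B : Matrix κ ι ℝ) (c : κ → ℝ), ∀ x ∈ S, u x = lmap B c x

/-- `u` is piecewise affine on `Ω`. -/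
def IsPiecewiseAffineOn [Fintype ι] (u : (ι → ℝ) → κ → ℝ) (Ω : Set (ι → ℝ)) : Prop :=
  ∃ 𝒮 : Set (Set (ι → ℝ)), 𝒮.Countable ∧
    (∀ V ∈ 𝒮, IsRegularDomain V ∧ V ⊆ Ω ∧ IsAffineOn u V) ∧
    𝒮.PairwiseDisjoint id ∧ volume (Ω \ ⋃₀ 𝒮) = 0

/-- `G` is the weak (distributional) gradient of `u` on `Ω`, and `u ∈ W^{1,1}(Ω)`. -/
structure HasWeakGradientOn [Fintype ι] [DecidableEq ι] [Fintype κ]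
    (u : (ι → ℝ) → κ → ℝ) (G : (ι → ℝ) → Matrix κ ι ℝ) (Ω : Set (ι → ℝ)) : Prop where
  integrable : IntegrableOn u Ω volume
  integrable_grad : ∀ (k : κ) (i : ι), IntegrableOn (fun x => G x k i) Ω volume
  parts : ∀ φ : (ι → ℝ) → ℝ, (∀ n : ℕ, ContDiff ℝ n φ) → HasCompactSupport φ →
    tsupport φ ⊆ Ω → ∀ (k : κ) (i : ι),
      ∫ x in Ω, u x k * fderiv ℝ φ x (Pi.single i 1) = - ∫ x in Ω, G x k i * φ x

/-- Membership in `C^α(S)`: continuous on `S` and (for `α > 0`) `α`-Hölder on `S`. -/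
def MemHolder [Fintype ι] [Fintype κ] (α : ℝ) (S : Set (ι → ℝ)) (u : (ι → ℝ) → κ → ℝ) : Prop :=
  ContinuousOn u S ∧ ∃ C : ℝ, ∀ x ∈ S, ∀ y ∈ S, dist (u x) (u y) ≤ C * dist x y ^ α

/-- The `C^α` norm on `S`. -/
def holderNorm [Fintype ι] [Fintype κ] (α : ℝ) (S : Set (ι → ℝ)) (u : (ι → ℝ) → κ → ℝ) : ℝ :=
  sSup ((fun x => ‖u x‖) '' S) +
    sSup {r : ℝ | ∃ x ∈ S, ∃ y ∈ S, x ≠ y ∧ r = dist (u x) (u y) / dist x y ^ α}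

/-- `K` can be reduced to `K'` in weak `L^p`, with constant `M`. -/
def ReducesWith [Fintype ι] [DecidableEq ι] [Fintype κ] (M : ℝ)
    (K K' : Set (Matrix κ ι ℝ)) (p : ℝ) : Prop :=
  ∀ A ∈ K, ∀ b : κ → ℝ, ∀ ε ∈ Set.Ioo (0:ℝ) 1, ∀ α ∈ Set.Ioo (0:ℝ) 1, ∀ s ∈ Set.Ioi (1:ℝ),
    ∀ Ω : Set (ι → ℝ), IsRegularDomain Ω →
      ∃ (u : (ι → ℝ) → κ → ℝ) (G : (ι → ℝ) → Matrix κ ι ℝ),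
        IsPiecewiseAffineOn u Ω ∧ HasWeakGradientOn u G Ω ∧ MemHolder α (closure Ω) u ∧
        (∀ x ∈ frontier Ω, u x = lmap A b x) ∧
        (∫ x in {x ∈ Ω | G x ∉ K'}, (1 + frobNorm (G x)) ^ s) < ε * (volume Ω).toReal ∧
        ∀ t : ℝ, 0 < t →
          volume {x ∈ Ω | t < frobNorm (G x)}
            ≤ ENNReal.ofReal (M ^ p * (1 + frobNorm A ^ p) * t ^ (-p)) * volume Ω

/-- `K` can be reduced to `K'` in weak `L^p`. -/
def ReducedTo [Fintype ι] [DecidableEq ι] [Fintype κ]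
    (K K' : Set (Matrix κ ι ℝ)) (p : ℝ) : Prop :=
  ∃ M : ℝ, 1 ≤ M ∧ ReducesWith M K K' p

/-- Block-diagonal `2n×2n` matrices (w.r.t. the splitting `ℝ^{2n} = ℝ^n × ℝ^n`). -/
def L1set (n : ℕ) : Set (Matrix (Fin n ⊕ Fin n) (Fin n ⊕ Fin n) ℝ) :=
  {X | (∀ i j, X (Sum.inl i) (Sum.inr j) = 0) ∧ (∀ i j, X (Sum.inr i) (Sum.inl j) = 0)}

/-- Block anti-diagonal `2n×2n` matrices. -/
def L2set (n : ℕ) : Set (Matrix (Fin n ⊕ Fin n) (Fin n ⊕ Fin n) ℝ) :=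
  {X | (∀ i j, X (Sum.inl i) (Sum.inl j) = 0) ∧ (∀ i j, X (Sum.inr i) (Sum.inr j) = 0)}

/-- Split matrices `L = L₁ ∪ L₂`. -/
def LSet (n : ℕ) : Set (Matrix (Fin n ⊕ Fin n) (Fin n ⊕ Fin n) ℝ) := L1set n ∪ L2set n

/-- Matrices of determinant one. -/
def SigmaSet (n : ℕ) : Set (Matrix (Fin n ⊕ Fin n) (Fin n ⊕ Fin n) ℝ) := {X | X.det = 1}

/-- The piecewise linear ramp of width `δ`, equal to `0` on negative numbers and to `1`
beyond `δ`. -/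
def ramp (δ t : ℝ) : ℝ := max 0 (min 1 (t / δ))

lemma ramp_mono {δ : ℝ} (hδ : 0 < δ) : Monotone (ramp δ) := fun a b h => by
  unfold ramp; gcongr

lemma ramp_nonneg (δ t : ℝ) : 0 ≤ ramp δ t := le_max_left _ _

lemma ramp_le_one (δ t : ℝ) : ramp δ t ≤ 1 := max_le zero_le_one (min_le_left _ _)

lemma ramp_of_nonpos {δ t : ℝ} (hδ : 0 < δ) (ht : t ≤ 0) : ramp δ t = 0 := by
  have : t / δ ≤ 0 := div_nonpos_of_nonpos_of_nonneg ht hδ.le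
  unfold ramp
  exact max_eq_left ((min_le_right _ _).trans this)

lemma ramp_of_ge {δ t : ℝ} (hδ : 0 < δ) (ht : δ ≤ t) : ramp δ t = 1 := by
  have : 1 ≤ t / δ := (one_le_div hδ).2 ht
  unfold ramp
  rw [min_eq_left this, max_eq_right zero_le_one]

lemma continuous_ramp (δ : ℝ) : Continuous (ramp δ) := by unfold ramp; fun_prop

/-- A `C¹` periodic sawtooth whose slope is `1 - l` or `-l` away from small phase intervals. -/
lemma exists_sawtooth {l δ : ℝ} (hδ : 0 < δ) (hδl : δ ≤ l) (hlδ : l + δ ≤ 1) :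
    ∃ h : ℝ → ℝ, ContDiff ℝ 1 h ∧ (∀ t, |h t| ≤ 1) ∧ (∀ t, |deriv h t| ≤ 1) ∧
      (∀ t, δ < Int.fract t → Int.fract t < l → deriv h t = 1 - l) ∧
      (∀ t, l + δ < Int.fract t → deriv h t = -l) := by
  set g : ℝ → ℝ := fun t => ramp δ (Int.fract t) - ramp δ (Int.fract t - l) - l with hg
  have hgc : Continuous g := by
    have h0 : Continuous fun t : ℝ => (fun s => ramp δ s - ramp δ (s - l) - l) (Int.fract t) := by
      refine ContinuousOn.comp_fract'' (f := fun s => ramp δ s - ramp δ (s - l) - l) ?_ ?_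
      · have := continuous_ramp δ
        fun_prop
      · rw [ramp_of_nonpos hδ le_rfl, ramp_of_nonpos hδ (by linarith), ramp_of_ge hδ (by linarith),
          ramp_of_ge hδ (by linarith)]
        ring
    exact h0
  have hper : Function.Periodic g 1 := fun t => by simp [hg]
  have hinteg : ∀ a b : ℝ, IntervalIntegrable (ramp δ) volume a b := fun a b =>
    (continuous_ramp δ).intervalIntegrable _ _
  have hmean : ∫ t in (0:ℝ)..1, g t = 0 := by
    have h1 : ∫ t in (0:ℝ)..1, g t = ∫ t in (0:ℝ)..1, (ramp δ t - ramp δ (t - l) - l) := by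
      refine intervalIntegral.integral_congr_ae ?_
      have : ∀ᵐ t : ℝ, t ≠ 1 := by simp [ae_iff]
      filter_upwards [this] with t ht ht'
      rw [uIoc_of_le zero_le_one] at ht'
      have : Int.fract t = t := Int.fract_eq_self.2 ⟨ht'.1.le, lt_of_le_of_ne ht'.2 ht⟩
      simp only [hg, this]
    have hc := continuous_ramp δ
    have i1 : IntervalIntegrable (fun t => ramp δ (t - l)) volume 0 1 :=
      (by fun_prop : Continuous fun t => ramp δ (t - l)).intervalIntegrable _ _
    rw [h1, intervalIntegral.integral_sub ((hinteg _ _).sub i1) (by simp),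
      intervalIntegral.integral_sub (hinteg _ _) i1, intervalIntegral.integral_comp_sub_right]
    rw [← intervalIntegral.integral_add_adjacent_intervals (hinteg 0 (1 - l)) (hinteg (1 - l) 1),
      ← intervalIntegral.integral_add_adjacent_intervals (hinteg (0 - l) 0) (hinteg 0 (1 - l))]
    have e1 : ∫ t in (1 - l)..1, ramp δ t = l := by
      rw [intervalIntegral.integral_congr (g := fun _ => (1:ℝ))]
      · simp
      · intro t ht
        rw [uIcc_of_le (by linarith)] at ht
        exact ramp_of_ge hδ (by linarith [ht.1])
    have e2 : ∫ t in (0 - l)..0, ramp δ t = 0 := by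
      rw [intervalIntegral.integral_congr (g := fun _ => (0:ℝ))]
      · simp
      · intro t ht
        rw [uIcc_of_le (by linarith)] at ht
        exact ramp_of_nonpos hδ ht.2
    rw [e1, e2]
    simp
  have hg1 : ∀ t, |g t| ≤ 1 := fun t => by
    have := ramp_mono hδ (show Int.fract t - l ≤ Int.fract t by linarith)
    have := ramp_le_one δ (Int.fract t)
    have := ramp_nonneg δ (Int.fract t - l)
    rw [abs_le]
    constructor <;> simp only [hg] <;> linarith
  have hd : ∀ t, HasDerivAt (fun t => ∫ s in (0:ℝ)..t, g s) (g t) t := fun t =>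
    hgc.integral_hasStrictDerivAt 0 t |>.hasDerivAt
  have hderiv : deriv (fun t => ∫ s in (0:ℝ)..t, g s) = g := funext fun t => (hd t).deriv
  refine ⟨fun t => ∫ s in (0:ℝ)..t, g s, ?_, ?_, ?_, ?_, ?_⟩
  · rw [contDiff_one_iff_deriv, hderiv]
    exact ⟨fun t => (hd t).differentiableAt, hgc⟩
  · have hP : Function.Periodic (fun t => ∫ s in (0:ℝ)..t, g s) 1 := fun t => by
      beta_reduce
      rw [← intervalIntegral.integral_add_adjacent_intervals (hgc.intervalIntegrable 0 t)
        (hgc.intervalIntegrable t (t + 1)), hper.intervalIntegral_add_eq t 0, zero_add, hmean,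
        add_zero]
    intro t
    obtain ⟨s, hs, hst⟩ := hP.exists_mem_Ico₀ one_pos t
    beta_reduce
    rw [hst]
    have := intervalIntegral.norm_integral_le_of_norm_le_const (a := 0) (b := s) (C := 1) (f := g)
      fun x _ => hg1 x
    rw [Real.norm_eq_abs, sub_zero, abs_of_nonneg hs.1] at this
    linarith [hs.2]
  · rw [hderiv]; exact hg1
  · intro t h1 h2
    rw [hderiv]
    simp only [hg]
    rw [ramp_of_ge hδ h1.le, ramp_of_nonpos hδ (by linarith)]
    ring
  · intro t h1
    rw [hderiv]
    simp only [hg]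
    rw [ramp_of_ge hδ (by linarith), ramp_of_ge hδ (by linarith)]
    ring

/-- Among all phases there is one for which a periodic weight is at most its mean. -/
lemma exists_phase_le {E : Type*} [MeasurableSpace E] {μ : Measure E} [SFinite μ] {U : Set E}
    (hU : μ U ≠ ⊤) {L : E → ℝ} (hL : Measurable L) {q : ℝ → ℝ} (hq : Measurable q)
    (hper : Function.Periodic q 1) {B : ℝ} (hB : ∀ t, |q t| ≤ B) :
    ∃ θ : ℝ, ∫ x in U, q (L x + θ) ∂μ ≤ (∫ t in (0:ℝ)..1, q t) * μ.real U := by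
  have : IsFiniteMeasure (μ.restrict U) := ⟨by simpa using hU.lt_top⟩
  have hm : Measurable fun p : ℝ × E => q (L p.2 + p.1) :=
    hq.comp ((hL.comp measurable_snd).add measurable_fst)
  have hinteg : Integrable (Function.uncurry fun (θ : ℝ) (x : E) => q (L x + θ))
      ((volume.restrict (Set.uIoc 0 1)).prod (μ.restrict U)) := by
    have : IsFiniteMeasure (volume.restrict (Set.uIoc (0:ℝ) 1)) := by
      rw [uIoc_of_le zero_le_one]; infer_instance
    exact Integrable.of_bound hm.aestronglyMeasurable B (ae_of_all _ fun p => hB _)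
  have hswap := intervalIntegral_integral_swap hinteg
  have hin : ∀ x, ∫ θ in (0:ℝ)..1, q (L x + θ) = ∫ t in (0:ℝ)..1, q t := fun x => by
    rw [intervalIntegral.integral_comp_add_left (fun t => q t) (L x), add_zero,
      hper.intervalIntegral_add_eq (L x) 0, zero_add]
  simp only [hin, integral_const, measureReal_restrict_apply_univ, smul_eq_mul] at hswap
  have hI : IntegrableOn (fun θ => ∫ x in U, q (L x + θ) ∂μ) (Set.uIoc 0 1) volume :=
    hinteg.integral_prod_left
  rw [uIoc_of_le zero_le_one] at hI
  obtain ⟨θ, -, hθ⟩ := exists_le_setAverage (by simp) (by simp) hI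
  refine ⟨θ, hθ.trans_eq ?_⟩
  rw [setAverage_eq, ← intervalIntegral.integral_of_le zero_le_one, hswap]
  simp [mul_comm]

lemma isOpen_fract_mem_Ioo {a b : ℝ} (ha : 0 ≤ a) : IsOpen {t : ℝ | Int.fract t ∈ Ioo a b} := by
  rw [isOpen_iff_mem_nhds]
  intro t ht
  have h1 : t ≠ ⌊t⌋ := fun h => by
    have h2 : Int.fract t = 0 := by rw [Int.fract]; linarith
    have := ht.1
    linarith
  exact (continuousAt_fract h1).preimage_mem_nhds (isOpen_Ioo.mem_nhds ht)

/-- Some phase of a linear function falls rarely into two short bad intervals, and into a given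
interval at most as often as expected. -/
lemma exists_phase_volume_le {E : Type*} [MeasurableSpace E] {μ : Measure E} [SFinite μ]
    {U : Set E} (hU : μ U ≠ ⊤) {l ε : ℝ} (hl : l ∈ Ioo (0 : ℝ) 1)
    (hε : 0 < ε) :
    ∃ δ, 0 < δ ∧ δ ≤ l ∧ l + δ ≤ 1 ∧ ∀ L : E → ℝ, Measurable L → ∃ θ : ℝ,
      μ.real {x ∈ U | Int.fract (L x + θ) ∈ Ioo δ l} ≤ l * μ.real U + ε ∧
      μ.real {x ∈ U | Int.fract (L x + θ) ∈ Iic δ ∪ Icc l (l + δ)} ≤ ε := by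
  set m := μ.real U with hm
  have hm0 : 0 ≤ m := measureReal_nonneg
  obtain ⟨k, hk0, hk⟩ : ∃ k : ℝ, 0 < k ∧ l * m + ε ≤ k * ε := by
    refine ⟨(l * m + ε) / ε, by have := hl.1; positivity, ?_⟩
    rw [div_mul_cancel₀ _ hε.ne']
  obtain ⟨δ, hδ0, hδ⟩ : ∃ δ : ℝ, 0 < δ ∧ δ ≤ l ∧ δ ≤ 1 - l ∧ 2 * k * δ * m ≤ ε := by
    refine ⟨min (min l (1 - l)) (ε / (2 * k * (m + 1))), ?_, ?_, ?_, ?_⟩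
    · have h0 := hl.1
      have h1 := hl.2
      simp only [lt_min_iff]
      exact ⟨⟨h0, by linarith⟩, by positivity⟩
    · exact (min_le_left _ _).trans (min_le_left _ _)
    · exact (min_le_left _ _).trans (min_le_right _ _)
    · calc 2 * k * min (min l (1 - l)) (ε / (2 * k * (m + 1))) * m
          ≤ 2 * k * (ε / (2 * k * (m + 1))) * (m + 1) := by
            gcongr
            · exact min_le_right _ _
            · linarith
        _ = ε := by field_simp
  refine ⟨δ, hδ0, hδ.1, by linarith [hδ.2.1], fun L hL => ?_⟩
  set A : Set ℝ := {t | Int.fract t ∈ Ioo δ l} with hA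
  set B : Set ℝ := {t | Int.fract t ∈ Iic δ ∪ Icc l (l + δ)} with hB
  have hAm : MeasurableSet A := measurable_fract measurableSet_Ioo
  have hBm : MeasurableSet B := measurable_fract (measurableSet_Iic.union measurableSet_Icc)
  set q : ℝ → ℝ := fun t => A.indicator 1 t + k * B.indicator 1 t with hq
  have hqm : Measurable q :=
    (measurable_one.indicator hAm).add ((measurable_one.indicator hBm).const_mul k)
  have hper : Function.Periodic q 1 := fun t => by
    simp [hq, hA, hB, indicator]
  have i01 : ∀ S : Set ℝ, ∀ t, S.indicator (1 : ℝ → ℝ) t ∈ Icc (0 : ℝ) 1 := fun S t => by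
    by_cases h : t ∈ S <;> simp [h]
  have hB' : ∀ t, |q t| ≤ 1 + k := fun t => by
    have h1 := i01 A t
    have h2 := i01 B t
    rw [abs_le]
    constructor <;> simp only [hq] <;> nlinarith [h1.1, h1.2, h2.1, h2.2]
  obtain ⟨θ, hθ⟩ := exists_phase_le hU hL hqm hper hB'
  have hmean : ∫ t in (0:ℝ)..1, q t ≤ l + 2 * k * δ := by
    rw [intervalIntegral.integral_of_le zero_le_one]
    have ii : ∀ S : Set ℝ, MeasurableSet S →
        IntegrableOn (S.indicator (1 : ℝ → ℝ)) (Ioc 0 1) volume := fun S hS =>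
      Integrable.of_bound (measurable_one.indicator hS).aestronglyMeasurable 1
        (ae_of_all _ fun t => by
          rw [Real.norm_eq_abs, abs_of_nonneg (i01 S t).1]; exact (i01 S t).2)
    simp only [hq]
    rw [integral_add (ii A hAm) ((ii B hBm).const_mul k), integral_const_mul,
      integral_indicator_one hAm, integral_indicator_one hBm,
      measureReal_restrict_apply hAm, measureReal_restrict_apply hBm]
    have hfr : ∀ t ∈ Ioc (0:ℝ) 1, t ≠ 1 → Int.fract t = t := fun t ht h1 =>
      Int.fract_eq_self.2 ⟨ht.1.le, lt_of_le_of_ne ht.2 h1⟩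
    have vA : volume.real (A ∩ Ioc 0 1) ≤ l := by
      calc volume.real (A ∩ Ioc 0 1) ≤ volume.real (Icc (0:ℝ) l) := by
            refine measureReal_mono ?_ (by simp)
            rintro t ⟨h1, h2⟩
            have hne : t ≠ 1 := by
              rintro rfl
              have h3 : Int.fract (1:ℝ) ∈ Ioo δ l := h1
              simp only [Int.fract_one, mem_Ioo] at h3
              linarith [h3.1]
            have h3 : Int.fract t ∈ Ioo δ l := h1
            rw [hfr t h2 hne] at h3
            exact ⟨h2.1.le, h3.2.le⟩
        _ = l := by simp [hl.1.le]
    have vB : volume.real (B ∩ Ioc 0 1) ≤ 2 * δ := by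
      calc volume.real (B ∩ Ioc 0 1)
          ≤ volume.real (Icc (0:ℝ) δ ∪ Icc l (l + δ) ∪ {1}) := by
            refine measureReal_mono ?_ (measure_union_ne_top
              (measure_union_ne_top (by simp) (by simp)) (by simp))
            rintro t ⟨h1, h2⟩
            by_cases hne : t = 1
            · right; exact hne
            left
            have h3 : Int.fract t ∈ Iic δ ∪ Icc l (l + δ) := h1
            rw [hfr t h2 hne] at h3
            rcases h3 with h3 | h3
            · left; exact ⟨h2.1.le, h3⟩
            · right; exact h3
        _ ≤ volume.real (Icc (0:ℝ) δ) + volume.real (Icc l (l + δ)) + volume.real {(1:ℝ)} :=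
            (measureReal_union_le _ _).trans (by gcongr; exact measureReal_union_le _ _)
        _ = 2 * δ := by simp [hδ0.le, measureReal_def]; ring
    nlinarith
  have hinteg : ∫ x in U, q (L x + θ) ∂μ =
      μ.real {x ∈ U | Int.fract (L x + θ) ∈ Ioo δ l} +
      k * μ.real {x ∈ U | Int.fract (L x + θ) ∈ Iic δ ∪ Icc l (l + δ)} := by
    have hT : Measurable fun x => L x + θ := hL.add_const θ
    have : IsFiniteMeasure (μ.restrict U) := ⟨by simpa using hU.lt_top⟩
    have hAm' : MeasurableSet ((fun x => L x + θ) ⁻¹' A) := hT hAm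
    have hBm' : MeasurableSet ((fun x => L x + θ) ⁻¹' B) := hT hBm
    have e : (fun x => q (L x + θ)) = fun x =>
        ((fun x => L x + θ) ⁻¹' A).indicator (1 : E → ℝ) x +
        k * ((fun x => L x + θ) ⁻¹' B).indicator (1 : E → ℝ) x := by
      funext x; simp [hq, indicator]
    have ii : ∀ S : Set E, MeasurableSet S →
        Integrable (S.indicator (1 : E → ℝ)) (μ.restrict U) := fun S hS =>
      Integrable.of_bound (measurable_one.indicator hS).aestronglyMeasurable 1
        (ae_of_all _ fun t => by by_cases h : t ∈ S <;> simp [h])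
    rw [e, integral_add (ii _ hAm') ((ii _ hBm').const_mul k), integral_const_mul,
      integral_indicator_one hAm', integral_indicator_one hBm',
      measureReal_restrict_apply hAm', measureReal_restrict_apply hBm', inter_comm _ U,
      inter_comm _ U]
    rfl
  have hA0 : 0 ≤ μ.real {x ∈ U | Int.fract (L x + θ) ∈ Ioo δ l} := measureReal_nonneg
  have hB0 : 0 ≤ μ.real {x ∈ U | Int.fract (L x + θ) ∈ Iic δ ∪ Icc l (l + δ)} :=
    measureReal_nonneg
  rw [hinteg, ← hm] at hθ
  have hkB := mul_nonneg hk0.le hB0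
  have hfin : (∫ t in (0:ℝ)..1, q t) * m ≤ l * m + ε := by nlinarith
  refine ⟨θ, ?_, ?_⟩
  · linarith
  · have : k * μ.real {x ∈ U | Int.fract (L x + θ) ∈ Iic δ ∪ Icc l (l + δ)} ≤ k * ε := by
      linarith
    exact le_of_mul_le_mul_left this hk0

/-- A smooth cutoff function of an open set, equal to one on an open set of almost full measure. -/
lemma exists_cutoff [Fintype ι] {U : Set (ι → ℝ)} (hU : IsOpen U)
    (hb : Bornology.IsBounded U) {ε : ℝ} (hε : 0 < ε) :
    ∃ (φ : (ι → ℝ) → ℝ) (V : Set (ι → ℝ)), ContDiff ℝ 1 φ ∧ HasCompactSupport φ ∧ tsupport φ ⊆ U ∧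
      (∀ x, φ x ∈ Icc (0 : ℝ) 1) ∧ IsOpen V ∧ V ⊆ U ∧ (∀ x ∈ V, φ x = 1) ∧
      volume.real (U \ V) ≤ ε := by
  obtain ⟨K, hKU, hK, hvol⟩ := hU.measurableSet.exists_isCompact_sdiff_lt (μ := volume)
    hb.measure_lt_top.ne (ENNReal.ofReal_pos.2 hε).ne'
  obtain ⟨K', hK', hKK', hK'U⟩ := exists_compact_between hK hU hKU
  obtain ⟨φ, h1, h0, h01⟩ := exists_contMDiffMap_one_nhds_of_subset_interior
    (modelWithCornersSelf ℝ (ι → ℝ)) (n := 1) hK.isClosed hKK'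
  have hts : tsupport φ ⊆ K' := by
    refine closure_minimal (fun x hx => ?_) hK'.isClosed
    by_contra h
    exact hx (h0 x h)
  refine ⟨φ, interior {x | φ x = 1} ∩ U, contMDiff_iff_contDiff.1 φ.contMDiff,
    hK'.of_isClosed_subset (isClosed_tsupport _) hts, hts.trans hK'U, h01,
    isOpen_interior.inter hU, inter_subset_right,
    fun x hx => interior_subset (s := {x | φ x = 1}) hx.1, ?_⟩
  have hKi : K ⊆ interior {x | φ x = 1} ∩ U := fun x hx =>
    ⟨mem_interior_iff_mem_nhds.2 (h1.filter_mono (nhds_le_nhdsSet hx)), hKU hx⟩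
  have : volume (U \ (interior {x | φ x = 1} ∩ U)) ≤ ENNReal.ofReal ε :=
    (measure_mono (sdiff_subset_sdiff_right hKi)).trans hvol.le
  exact ENNReal.toReal_le_of_le_ofReal hε.le this

lemma le_rpow_mul_rpow {z a b α : ℝ} (hz : 0 ≤ z) (ha : z ≤ a) (hb : z ≤ b)
    (hα : α ∈ Ico (0 : ℝ) 1) : z ≤ a ^ (1 - α) * b ^ α := by
  calc z = z ^ (1 - α) * z ^ α := by
        rw [← Real.rpow_add_of_nonneg hz (by linarith [hα.2]) hα.1]; simp
    _ ≤ a ^ (1 - α) * b ^ α := by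
        have h1 := hα.1
        have h2 := hα.2
        have ha0 := hz.trans ha
        gcongr

lemma opNorm_le_sum_abs [Fintype ι] [DecidableEq ι] (T : (ι → ℝ) →L[ℝ] ℝ) :
    ‖T‖ ≤ ∑ i, |T (Pi.single i 1)| := by
  refine T.opNorm_le_bound (Finset.sum_nonneg fun i _ => abs_nonneg _) fun v => ?_
  have hv : T v = ∑ i, v i * T (Pi.single i 1) := by
    conv_lhs => rw [← Finset.univ_sum_single v]
    rw [map_sum]
    refine Finset.sum_congr rfl fun i _ => ?_
    rw [← smul_eq_mul, ← map_smul, ← Pi.single_smul', smul_eq_mul, mul_one]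
  rw [hv, Finset.sum_mul]
  refine (norm_sum_le _ _).trans (Finset.sum_le_sum fun i _ => ?_)
  rw [norm_mul, mul_comm, Real.norm_eq_abs]
  gcongr
  exact norm_le_pi_norm v i

/-- A compactly supported scalar oscillation whose gradient is mostly `(1 - l) b` or `-l b`. -/
lemma exists_oscillation [Fintype ι] [DecidableEq ι] {U : Set (ι → ℝ)} (hU : IsOpen U)
    (hb : Bornology.IsBounded U) (b : ι → ℝ) {l : ℝ} (hl : l ∈ Ioo (0 : ℝ) 1) {ε : ℝ} (hε : 0 < ε)
    {α : ℝ} (hα : α ∈ Ico (0 : ℝ) 1) :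
    ∃ (f : (ι → ℝ) → ℝ) (U₁ U₂ : Set (ι → ℝ)), ContDiff ℝ 1 f ∧ HasCompactSupport f ∧
      tsupport f ⊆ U ∧ (∀ x, |f x| ≤ ε) ∧ (∀ x y, |f x - f y| ≤ ε * dist x y ^ α) ∧
      (∀ x i, |fderiv ℝ f x (Pi.single i 1)| ≤ |b i| + 1) ∧
      IsOpen U₁ ∧ IsOpen U₂ ∧ Disjoint U₁ U₂ ∧ U₁ ⊆ U ∧ U₂ ⊆ U ∧
      (∀ x ∈ U₁, ∀ i, fderiv ℝ f x (Pi.single i 1) = (1 - l) * b i) ∧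
      (∀ x ∈ U₂, ∀ i, fderiv ℝ f x (Pi.single i 1) = -l * b i) ∧
      volume.real U₁ ≤ l * volume.real U + ε ∧ volume.real (U \ (U₁ ∪ U₂)) ≤ ε := by
  obtain ⟨φ, V, hφ, hφc, hφU, hφ01, hV, hVU, hφV, hvol⟩ := exists_cutoff hU hb (half_pos hε)
  obtain ⟨δ, hδ0, hδl, hlδ, hphase⟩ := exists_phase_volume_le (μ := (volume : Measure (ι → ℝ)))
    hb.measure_lt_top.ne hl (half_pos hε)
  obtain ⟨h, hh, hh1, hh1', hslope1, hslope2⟩ := exists_sawtooth hδ0 hδl hlδ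
  obtain ⟨M, hM⟩ : ∃ M : ℝ, ∀ x, ‖fderiv ℝ φ x‖ ≤ M :=
    (hφ.continuous_fderiv one_ne_zero).bounded_above_of_compact_support (hφc.fderiv ℝ)
  set R : ℝ := ∑ i, (|b i| + 1) with hR
  have hR0 : 0 ≤ R := Finset.sum_nonneg fun i _ => by positivity
  obtain ⟨N, hN0, hNε, hNα, hNM⟩ : ∃ N : ℝ, 0 < N ∧ 1 / N ≤ ε ∧
      (2 / N) ^ (1 - α) * R ^ α ≤ ε ∧ M / N ≤ 1 := by
    have t0 : ∀ c : ℝ, Tendsto (fun N : ℝ => c / N) atTop (𝓝 0) := fun c =>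
      tendsto_const_nhds.div_atTop tendsto_id
    have t1 : Tendsto (fun N : ℝ => (2 / N) ^ (1 - α) * R ^ α) atTop (𝓝 0) := by
      have h1 : 0 < 1 - α := by linarith [hα.2]
      have := ((t0 2).rpow_const (p := 1 - α) (Or.inr h1.le)).mul_const (R ^ α)
      rwa [Real.zero_rpow h1.ne', zero_mul] at this
    exact ((eventually_gt_atTop 0).and (((t0 1).eventually_le_const hε).and
      ((t1.eventually_le_const hε).and ((t0 M).eventually_le_const one_pos)))).exists
  set L : (ι → ℝ) →L[ℝ] ℝ := N • ∑ i, b i • ContinuousLinearMap.proj (R := ℝ) i with hL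
  have hLs : ∀ i, L (Pi.single i 1) = N * b i := fun i => by
    simp [hL, Pi.single_apply]
  clear_value L
  obtain ⟨θ, hθ1, hθ2⟩ := hphase L L.continuous.measurable
  set w : (ι → ℝ) → ℝ := fun x => h (L x + θ) / N with hw
  have hwd : ∀ x, HasFDerivAt w ((deriv h (L x + θ) / N) • L) x := fun x => by
    have h1 : HasDerivAt h (deriv h (L x + θ)) (L x + θ) :=
      ((hh.differentiable one_ne_zero) _).hasDerivAt
    have h2 : HasFDerivAt (fun x => L x + θ) L x := L.hasFDerivAt.add_const θ
    have h3 := (h1.comp_hasFDerivAt x h2).mul_const (1 / N)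
    have e : (deriv h (L x + θ) / N) • L = (1 / N) • deriv h (L x + θ) • L := by
      rw [← one_div_mul_eq_div, mul_smul]
    rw [e]
    refine h3.congr_of_eventuallyEq (Eventually.of_forall fun y => ?_)
    simp [hw, div_eq_mul_inv]
  have hwb : ∀ x, |w x| ≤ 1 / N := fun x => by
    simp only [hw]
    rw [abs_div, abs_of_pos hN0]
    gcongr
    exact hh1 _
  have hws : ContDiff ℝ 1 w := by
    have : ContDiff ℝ 1 fun x => L x + θ := L.contDiff.add contDiff_const
    exact (hh.comp this).div_const N
  set f : (ι → ℝ) → ℝ := fun x => φ x * w x with hf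
  have hfs : ContDiff ℝ 1 f := hφ.mul hws
  have hfd : ∀ x i, fderiv ℝ f x (Pi.single i 1) =
      φ x * (deriv h (L x + θ) * b i) + w x * fderiv ℝ φ x (Pi.single i 1) := fun x i => by
    have h1 := ((hφ.differentiable one_ne_zero) x).hasFDerivAt.mul (hwd x)
    have h2 : fderiv ℝ f x = _ := h1.fderiv
    rw [h2]
    simp only [add_apply, smul_apply, smul_eq_mul, hLs]
    field_simp
  have hfb : ∀ x, |f x| ≤ 1 / N := fun x => by
    simp only [hf]
    rw [abs_mul, abs_of_nonneg (hφ01 x).1]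
    calc φ x * |w x| ≤ 1 * (1 / N) := by
          gcongr
          · exact (hφ01 x).2
          · exact hwb x
      _ = 1 / N := one_mul _
  have hgrad : ∀ x i, |fderiv ℝ f x (Pi.single i 1)| ≤ |b i| + 1 := fun x i => by
    rw [hfd]
    refine (abs_add_le _ _).trans (add_le_add ?_ ?_)
    · rw [abs_mul, abs_mul, abs_of_nonneg (hφ01 x).1]
      calc φ x * (|deriv h (L x + θ)| * |b i|) ≤ 1 * (1 * |b i|) := by
            gcongr
            · exact (hφ01 x).2
            · exact hh1' _
        _ = |b i| := by ring
    · rw [abs_mul]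
      have h1 : |fderiv ℝ φ x (Pi.single i 1)| ≤ M := by
        refine ((fderiv ℝ φ x).le_opNorm _).trans ?_
        rw [Pi.norm_single, norm_one, mul_one]
        exact hM x
      calc |w x| * |fderiv ℝ φ x (Pi.single i 1)| ≤ 1 / N * M := by
            gcongr
            exact hwb x
        _ = M / N := by ring
        _ ≤ 1 := hNM
  have hlip : ∀ x y, |f x - f y| ≤ R * dist x y := fun x y => by
    rw [dist_eq_norm]
    exact convex_univ.norm_image_sub_le_of_norm_fderiv_le (𝕜 := ℝ)
      (fun z _ => (hfs.differentiable one_ne_zero) z)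
      (fun z _ => (opNorm_le_sum_abs _).trans (Finset.sum_le_sum fun i _ => hgrad z i))
      (mem_univ y) (mem_univ x)
  have hdφ : ∀ x ∈ V, fderiv ℝ φ x = 0 := fun x hx => by
    have : φ =ᶠ[𝓝 x] fun _ => 1 := by
      filter_upwards [hV.mem_nhds hx] with y hy using hφV y hy
    rw [this.fderiv_eq]; simp
  have hts : tsupport f ⊆ tsupport φ := tsupport_mul_subset_left
  have hLc : Continuous fun x => L x + θ := L.continuous.add_const θ
  refine ⟨f, V ∩ {x | Int.fract (L x + θ) ∈ Ioo δ l}, V ∩ {x | Int.fract (L x + θ) ∈ Ioo (l + δ) 1},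
    hfs, hφc.mul_right, hts.trans hφU, fun x => (hfb x).trans hNε, fun x y => ?_, hgrad,
    hV.inter ((isOpen_fract_mem_Ioo hδ0.le).preimage hLc),
    hV.inter ((isOpen_fract_mem_Ioo (by linarith [hl.1])).preimage hLc), ?_,
    inter_subset_left.trans hVU, inter_subset_left.trans hVU, ?_, ?_, ?_, ?_⟩
  · have h2 : |f x - f y| ≤ 2 / N := by
      have := abs_sub (f x) (f y)
      have := hfb x
      have := hfb y
      calc |f x - f y| ≤ 1 / N + 1 / N := by linarith
        _ = 2 / N := by ring
    refine (le_rpow_mul_rpow (abs_nonneg _) h2 (hlip x y) hα).trans ?_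
    rw [Real.mul_rpow hR0 dist_nonneg, ← mul_assoc]
    gcongr
  · rw [Set.disjoint_left]
    rintro x ⟨-, h1⟩ ⟨-, h2⟩
    have h3 := h1.2
    have h4 := h2.1
    linarith
  · rintro x ⟨hx, h1⟩ i
    rw [hfd, hdφ x hx, hφV x hx, hslope1 _ h1.1 h1.2]
    simp
  · rintro x ⟨hx, h1⟩ i
    rw [hfd, hdφ x hx, hφV x hx, hslope2 _ h1.1]
    simp
  · refine (measureReal_mono ?_ ?_).trans (hθ1.trans (by linarith))
    · rintro x ⟨hx, h1⟩
      exact ⟨hVU hx, h1⟩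
    · exact (hb.subset (sep_subset _ _)).measure_lt_top.ne
  · calc volume.real (U \ (V ∩ {x | Int.fract (L x + θ) ∈ Ioo δ l} ∪
            V ∩ {x | Int.fract (L x + θ) ∈ Ioo (l + δ) 1}))
        ≤ volume.real (U \ V ∪ {x ∈ U | Int.fract (L x + θ) ∈ Iic δ ∪ Icc l (l + δ)}) := by
          refine measureReal_mono ?_ (hb.subset (union_subset sdiff_subset
            (sep_subset _ _))).measure_lt_top.ne
          rintro x ⟨hxU, hx⟩
          by_cases hxV : x ∈ V
          · right
            refine ⟨hxU, ?_⟩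
            simp only [mem_union, mem_inter_iff, hxV, true_and, mem_ofPred_eq, not_or] at hx
            simp only [mem_Ioo, not_and_or, not_lt] at hx
            simp only [mem_union, mem_Iic, mem_Icc]
            have h4 := Int.fract_lt_one (L x + θ)
            rcases hx with ⟨h1 | h1, h2 | h2⟩
            · exact Or.inl h1
            · exact Or.inl h1
            · exact Or.inr ⟨h1, h2⟩
            · linarith
          · left; exact ⟨hxU, hxV⟩
      _ ≤ ε / 2 + ε / 2 := (measureReal_union_le _ _).trans (add_le_add hvol hθ2)
      _ = ε := add_halves ε

/-- A map vanishing outside `U`, small in `C^α`, with integrable weak gradient `G`. -/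
structure IsPerturbation [Fintype ι] [DecidableEq ι] (α ε : ℝ) (U : Set (ι → ℝ))
    (v : (ι → ℝ) → ι → ℝ) (G : (ι → ℝ) → Matrix ι ι ℝ) : Prop where
  continuous : Continuous v
  eq_zero : ∀ x ∉ U, v x = 0
  grad_eq_zero : ∀ x ∉ U, G x = 0
  norm_le : ∀ x, ‖v x‖ ≤ ε
  holder : ∀ x y, dist (v x) (v y) ≤ ε * dist x y ^ α
  integrable : ∀ k i, Integrable fun x => G x k i
  parts : ∀ φ : (ι → ℝ) → ℝ, ContDiff ℝ 1 φ → HasCompactSupport φ → ∀ k i,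
    ∫ x, v x k * fderiv ℝ φ x (Pi.single i 1) = - ∫ x, G x k i * φ x

lemma hasCompactSupport_fderiv_apply {φ : (ι → ℝ) → ℝ} (hφ : HasCompactSupport φ) (w : ι → ℝ) :
    HasCompactSupport fun x => fderiv ℝ φ x w :=
  (hφ.fderiv ℝ).comp_left (g := fun T : (ι → ℝ) →L[ℝ] ℝ => T w) (zero_apply w)

section

variable [Fintype ι]

lemma continuous_fderiv_apply {φ : (ι → ℝ) → ℝ} (hφ : ContDiff ℝ 1 φ) (w : ι → ℝ) :
    Continuous fun x => fderiv ℝ φ x w :=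
  (hφ.continuous_fderiv one_ne_zero).clm_apply continuous_const

lemma integrable_mul_of_hasCompactSupport {f φ : (ι → ℝ) → ℝ} (hf : Integrable f)
    (hφ : Continuous φ) (hc : HasCompactSupport φ) : Integrable fun x => f x * φ x := by
  obtain ⟨M, hM⟩ := hφ.bounded_above_of_compact_support hc
  exact hf.mul_bdd hφ.aestronglyMeasurable (ae_of_all _ hM)

lemma integrable_mul_fderiv {v φ : (ι → ℝ) → ℝ} (hv : Continuous v) (hφ : ContDiff ℝ 1 φ)
    (hc : HasCompactSupport φ) (w : ι → ℝ) : Integrable fun x => v x * fderiv ℝ φ x w :=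
  (hv.mul (continuous_fderiv_apply hφ w)).integrable_of_hasCompactSupport
    (hasCompactSupport_fderiv_apply hc w).mul_left

/-- A series of integrable functions with summable `L^1` norms is integrable. -/
lemma integrable_tsum {f : ℕ → (ι → ℝ) → ℝ} (hf : ∀ j, Integrable (f j))
    (hs : Summable fun j => ∫ x, |f j x|) : Integrable fun x => ∑' j, f j x := by
  refine ⟨AEStronglyMeasurable.tsum fun j => (hf j).1, ?_⟩
  rw [hasFiniteIntegral_iff_enorm]
  calc ∫⁻ x, ‖∑' j, f j x‖ₑ ≤ ∫⁻ x, ∑' j, ‖f j x‖ₑ :=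
        lintegral_mono fun x => enorm_tsum_le_tsum_enorm
    _ = ∑' j, ∫⁻ x, ‖f j x‖ₑ := lintegral_tsum fun j => (hf j).1.enorm
    _ = ∑' j, ENNReal.ofReal (∫ x, |f j x|) := by
        refine tsum_congr fun j => ?_
        exact (ofReal_integral_norm_eq_lintegral_enorm (hf j)).symm
    _ < ⊤ := hs.tsum_ofReal_lt_top

variable [DecidableEq ι]

namespace IsPerturbation

variable {α ε ε' : ℝ} {U U' : Set (ι → ℝ)} {v v' : (ι → ℝ) → ι → ℝ}
  {G G' : (ι → ℝ) → Matrix ι ι ℝ}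

lemma mono (h : IsPerturbation α ε U v G) (hε : ε ≤ ε') (hU : U ⊆ U') :
    IsPerturbation α ε' U' v G where
  continuous := h.continuous
  eq_zero x hx := h.eq_zero x fun h' => hx (hU h')
  grad_eq_zero x hx := h.grad_eq_zero x fun h' => hx (hU h')
  norm_le x := (h.norm_le x).trans hε
  holder x y := (h.holder x y).trans (by gcongr)
  integrable := h.integrable
  parts := h.parts

lemma add (h : IsPerturbation α ε U v G) (h' : IsPerturbation α ε' U v' G') :
    IsPerturbation α (ε + ε') U (fun x => v x + v' x) (fun x => G x + G' x) where
  continuous := h.continuous.add h'.continuous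
  eq_zero x hx := by rw [h.eq_zero x hx, h'.eq_zero x hx, add_zero]
  grad_eq_zero x hx := by rw [h.grad_eq_zero x hx, h'.grad_eq_zero x hx, add_zero]
  norm_le x := (norm_add_le _ _).trans (add_le_add (h.norm_le x) (h'.norm_le x))
  holder x y := (dist_add_add_le _ _ _ _).trans (by
    rw [add_mul]; exact add_le_add (h.holder x y) (h'.holder x y))
  integrable k i := (h.integrable k i).add (h'.integrable k i)
  parts φ hφ hc k i := by
    have c1 : Continuous fun x => v x k := (continuous_apply k).comp h.continuous
    have c2 : Continuous fun x => v' x k := (continuous_apply k).comp h'.continuous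
    simp only [Pi.add_apply, Matrix.add_apply, add_mul]
    rw [integral_add (integrable_mul_fderiv c1 hφ hc _) (integrable_mul_fderiv c2 hφ hc _),
      integral_add (integrable_mul_of_hasCompactSupport (h.integrable k i) hφ.continuous hc)
        (integrable_mul_of_hasCompactSupport (h'.integrable k i) hφ.continuous hc),
      h.parts φ hφ hc, h'.parts φ hφ hc, neg_add]

lemma tsum {ε : ℕ → ℝ} {v : ℕ → (ι → ℝ) → ι → ℝ} {G : ℕ → (ι → ℝ) → Matrix ι ι ℝ} {a : ℝ}
    (h : ∀ j, IsPerturbation α (ε j) U (v j) (G j)) (hε : HasSum ε a)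
    (hs : ∀ k i, Summable fun j => ∫ x, |G j x k i|) :
    IsPerturbation α a U (fun x => ∑' j, v j x)
      (fun x => Matrix.of fun k i => ∑' j, G j x k i) where
  continuous := continuous_tsum (fun j => (h j).continuous) hε.summable fun j x => (h j).norm_le x
  eq_zero x hx := by simp [fun j => (h j).eq_zero x hx]
  grad_eq_zero x hx := by ext k i; simp [fun j => (h j).grad_eq_zero x hx]
  norm_le x := tsum_of_norm_bounded hε fun j => (h j).norm_le x
  holder x y := by
    have hv : ∀ x, Summable fun j => v j x := fun x =>
      Summable.of_norm_bounded (g := ε) hε.summable fun j => (h j).norm_le x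
    rw [dist_eq_norm, ← (hv x).tsum_sub (hv y)]
    refine tsum_of_norm_bounded (hε.mul_right _) fun j => ?_
    rw [← dist_eq_norm]
    exact (h j).holder x y
  integrable k i := integrable_tsum (fun j => (h j).integrable k i) (hs k i)
  parts φ hφ hc k i := by
    have hsum : ∀ x, Summable fun j => v j x := fun x =>
      Summable.of_norm_bounded (g := ε) hε.summable fun j => (h j).norm_le x
    have hv : ∀ x, (∑' j, v j x) k = ∑' j, v j x k := fun x => tsum_apply (hsum x)
    have hcont : ∀ j, Continuous fun x => v j x k := fun j =>
      (continuous_apply k).comp (h j).continuous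
    have hD : Integrable fun x => fderiv ℝ φ x (Pi.single i 1) :=
      (continuous_fderiv_apply hφ _).integrable_of_hasCompactSupport
        (hasCompactSupport_fderiv_apply hc _)
    obtain ⟨M, hM⟩ := hφ.continuous.bounded_above_of_compact_support hc
    simp only [Matrix.of_apply, hv, ← tsum_mul_right]
    rw [← integral_tsum_of_summable_integral_norm
        (fun j => integrable_mul_fderiv (hcont j) hφ hc _),
      ← integral_tsum_of_summable_integral_norm (fun j =>
        integrable_mul_of_hasCompactSupport ((h j).integrable k i) hφ.continuous hc), ← tsum_neg]
    · exact tsum_congr fun j => (h j).parts φ hφ hc k i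
    · refine Summable.of_nonneg_of_le (fun j => integral_nonneg fun x => norm_nonneg _)
        (fun j => ?_) ((hs k i).mul_right M)
      rw [← integral_mul_const]
      refine integral_mono (integrable_mul_of_hasCompactSupport ((h j).integrable k i)
        hφ.continuous hc).norm (((h j).integrable k i).abs.mul_const M) fun x => ?_
      beta_reduce
      rw [norm_mul, Real.norm_eq_abs (G j x k i)]
      gcongr
      exact hM x
    · refine Summable.of_nonneg_of_le (fun j => integral_nonneg fun x => norm_nonneg _)
        (fun j => ?_) (hε.summable.mul_right (∫ x, ‖fderiv ℝ φ x (Pi.single i 1)‖))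
      rw [← integral_const_mul]
      refine integral_mono (integrable_mul_fderiv (hcont j) hφ hc _).norm
        (hD.norm.const_mul _) fun x => ?_
      beta_reduce
      rw [norm_mul]
      gcongr
      exact (norm_le_pi_norm _ k).trans ((h j).norm_le x)

end IsPerturbation

lemma isPerturbation_smul {α ε : ℝ} {U : Set (ι → ℝ)} {f : (ι → ℝ) → ℝ} (hf : ContDiff ℝ 1 f)
    (hc : HasCompactSupport f) (hU : tsupport f ⊆ U) (hε : ∀ x, |f x| ≤ ε)
    (hα : ∀ x y, |f x - f y| ≤ ε * dist x y ^ α) (a : ι → ℝ) :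
    IsPerturbation α (ε * ‖a‖) U (fun x => f x • a)
      (fun x => Matrix.vecMulVec a fun i => fderiv ℝ f x (Pi.single i 1)) where
  continuous := hf.continuous.smul continuous_const
  eq_zero x hx := by
    rw [image_eq_zero_of_notMem_tsupport fun h => hx (hU h), zero_smul]
  grad_eq_zero x hx := by
    rw [fderiv_of_notMem_tsupport (𝕜 := ℝ) fun h => hx (hU h)]
    ext k i
    simp [Matrix.vecMulVec_apply]
  norm_le x := by
    rw [norm_smul, Real.norm_eq_abs]
    exact mul_le_mul_of_nonneg_right (hε x) (norm_nonneg a)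
  holder x y := by
    rw [dist_eq_norm, ← sub_smul, norm_smul, Real.norm_eq_abs, mul_right_comm]
    exact mul_le_mul_of_nonneg_right (hα x y) (norm_nonneg a)
  integrable k i := by
    simp only [Matrix.vecMulVec_apply]
    exact ((continuous_fderiv_apply hf _).integrable_of_hasCompactSupport
      (hasCompactSupport_fderiv_apply hc _)).const_mul _
  parts φ hφ hφc k i := by
    simp only [Matrix.vecMulVec_apply, Pi.smul_apply, smul_eq_mul, mul_right_comm _ (a k), mul_assoc]
    simp only [← mul_assoc, mul_comm _ (a k)]
    simp only [mul_assoc, integral_const_mul, ← mul_neg]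
    rw [integral_mul_fderiv_eq_neg_fderiv_mul_of_integrable]
    · exact ((continuous_fderiv_apply hf _).mul hφ.continuous).integrable_of_hasCompactSupport
        hφc.mul_left
    · exact integrable_mul_fderiv hf.continuous hφ hφc _
    · exact (hf.continuous.mul hφ.continuous).integrable_of_hasCompactSupport hφc.mul_left
    · exact fun x _ => (hf.differentiable one_ne_zero) x
    · exact fun x _ => (hφ.differentiable one_ne_zero) x

end

section

variable [Fintype ι]

lemma frobNorm_nonneg (X : Matrix ι ι ℝ) : 0 ≤ frobNorm X := Real.sqrt_nonneg _

lemma abs_le_frobNorm (X : Matrix ι ι ℝ) (k i : ι) : |X k i| ≤ frobNorm X := by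
  refine Real.abs_le_sqrt ?_
  calc X k i ^ 2 ≤ ∑ j, X k j ^ 2 :=
        Finset.single_le_sum (f := fun j => X k j ^ 2) (fun j _ => sq_nonneg _) (Finset.mem_univ i)
    _ ≤ ∑ k, ∑ j, X k j ^ 2 :=
        Finset.single_le_sum (f := fun k => ∑ j, X k j ^ 2)
          (fun j _ => Finset.sum_nonneg fun _ _ => sq_nonneg _) (Finset.mem_univ k)

lemma frobNorm_le_sum_abs (X : Matrix ι ι ℝ) : frobNorm X ≤ ∑ k, ∑ i, |X k i| := by
  refine Real.sqrt_le_iff.2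
    ⟨Finset.sum_nonneg fun _ _ => Finset.sum_nonneg fun _ _ => abs_nonneg _, ?_⟩
  calc ∑ k, ∑ i, X k i ^ 2 ≤ ∑ k, (∑ i, |X k i|) ^ 2 := by
        refine Finset.sum_le_sum fun k _ => ?_
        simp_rw [← sq_abs (X k _)]
        exact Finset.sum_sq_le_sq_sum_of_nonneg fun _ _ => abs_nonneg _
    _ ≤ _ := Finset.sum_sq_le_sq_sum_of_nonneg fun _ _ =>
        Finset.sum_nonneg fun _ _ => abs_nonneg _

lemma lintegral_one_add_frobNorm_pow_le {E : Set (ι → ℝ)} (hE : MeasurableSet E)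
    (hE' : volume E ≠ ⊤) {Y : (ι → ℝ) → Matrix ι ι ℝ} {R δ : ℝ} (hR : 0 ≤ R)
    (hY : ∀ x ∈ E, frobNorm (Y x) ≤ R) (hδ : volume.real E ≤ δ) (N : ℕ) :
    ∫⁻ x in E, ENNReal.ofReal ((1 + frobNorm (Y x)) ^ N) ≤ ENNReal.ofReal ((1 + R) ^ N * δ) := by
  calc ∫⁻ x in E, ENNReal.ofReal ((1 + frobNorm (Y x)) ^ N)
      ≤ ∫⁻ x in E, ENNReal.ofReal ((1 + R) ^ N) := by
        refine setLIntegral_mono' hE fun x hx => ENNReal.ofReal_le_ofReal ?_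
        have := frobNorm_nonneg (Y x)
        have := hY x hx
        gcongr
    _ = ENNReal.ofReal ((1 + R) ^ N) * volume E := setLIntegral_const _ _
    _ ≤ ENNReal.ofReal ((1 + R) ^ N) * ENNReal.ofReal δ := by
        gcongr
        exact (ENNReal.le_ofReal_iff_toReal_le hE' (measureReal_nonneg.trans hδ)).2 hδ
    _ = _ := (ENNReal.ofReal_mul (by positivity)).symm

variable [DecidableEq ι]

/-- A perturbation of rank one whose gradient is mostly `(1 - l) a ⊗ b` or `-l a ⊗ b`. -/
lemma exists_rankOne_perturbation {U : Set (ι → ℝ)} (hU : IsOpen U)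
    (hb : Bornology.IsBounded U) (a b : ι → ℝ) {l : ℝ} (hl : l ∈ Ioo (0 : ℝ) 1) {ε : ℝ} (hε : 0 < ε)
    {α : ℝ} (hα : α ∈ Ico (0 : ℝ) 1) :
    ∃ (v : (ι → ℝ) → ι → ℝ) (G : (ι → ℝ) → Matrix ι ι ℝ) (U₁ U₂ : Set (ι → ℝ)),
      IsPerturbation α ε U v G ∧ (∀ x k i, |G x k i| ≤ |a k| * (|b i| + 1)) ∧
      IsOpen U₁ ∧ IsOpen U₂ ∧ Disjoint U₁ U₂ ∧ U₁ ⊆ U ∧ U₂ ⊆ U ∧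
      (∀ x ∈ U₁, G x = (1 - l) • Matrix.vecMulVec a b) ∧
      (∀ x ∈ U₂, G x = -l • Matrix.vecMulVec a b) ∧
      volume.real U₁ ≤ l * volume.real U + ε ∧ volume.real (U \ (U₁ ∪ U₂)) ≤ ε := by
  have hpos : 0 < 1 + ‖a‖ := by positivity
  obtain ⟨f, U₁, U₂, hf, hfc, hfU, hfε, hfα, hfD, o1, o2, hd, s1, s2, g1, g2, m1, m2⟩ :=
    exists_oscillation hU hb b hl (div_pos hε hpos) hα
  have hle : ε / (1 + ‖a‖) ≤ ε := div_le_self hε.le (by linarith [norm_nonneg a])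
  refine ⟨_, _, U₁, U₂, (isPerturbation_smul hf hfc hfU hfε hfα a).mono ?_ subset_rfl,
    fun x k i => ?_, o1, o2, hd, s1, s2, fun x hx => ?_, fun x hx => ?_, by linarith, by linarith⟩
  · rw [div_mul_eq_mul_div, div_le_iff₀ hpos]
    nlinarith [norm_nonneg a]
  · rw [Matrix.vecMulVec_apply, abs_mul]
    gcongr
    exact hfD x i
  · ext k i
    simp only [Matrix.vecMulVec_apply, Matrix.smul_apply, smul_eq_mul, g1 x hx i]
    ring
  · ext k i
    simp only [Matrix.vecMulVec_apply, Matrix.smul_apply, smul_eq_mul, g2 x hx i]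
    ring

/-- On every bounded open set, the linear map `X` has small perturbations whose gradient lies in
`K` outside a small bad set, with a weak `L^m` bound with constant `C`. -/
def Admissible (α : ℝ) (N m : ℕ) (K : Set (Matrix ι ι ℝ)) (C : ℝ) (X : Matrix ι ι ℝ) : Prop :=
  ∀ U : Set (ι → ℝ), IsOpen U → Bornology.IsBounded U → ∀ ε : ℝ, 0 < ε →
    ∃ (v : (ι → ℝ) → ι → ℝ) (G : (ι → ℝ) → Matrix ι ι ℝ) (B : Set (ι → ℝ)),
      IsPerturbation α ε U v G ∧ MeasurableSet B ∧ B ⊆ U ∧ (∀ x ∈ U \ B, X + G x ∈ K) ∧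
      ∫⁻ x in B, ENNReal.ofReal ((1 + frobNorm (X + G x)) ^ N) ≤ ENNReal.ofReal ε ∧
      ∀ t : ℝ, 0 < t →
        volume.real {x ∈ U \ B | t < frobNorm (X + G x)} * t ^ m ≤ C * volume.real U + ε

/-- Admissibility passes to convex combinations of rank-one connected matrices. -/
lemma Admissible.combine {α : ℝ} (hα : α ∈ Ico (0 : ℝ) 1) {N m : ℕ} {K : Set (Matrix ι ι ℝ)} {C : ℝ}
    (hC : 0 ≤ C) {X₁ X₂ : Matrix ι ι ℝ} (h₁ : Admissible α N m K C X₁)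
    (h₂ : Admissible α N m K C X₂) {a b : ι → ℝ} (hab : X₁ - X₂ = Matrix.vecMulVec a b) {l : ℝ}
    (hl : l ∈ Ioo (0 : ℝ) 1) : Admissible α N m K C (l • X₁ + (1 - l) • X₂) := by
  intro U hU hb ε hε
  set X := l • X₁ + (1 - l) • X₂ with hX
  set R : ℝ := ∑ k, ∑ i, (|X k i| + |a k| * (|b i| + 1)) with hR
  have hR0 : 0 ≤ R := Finset.sum_nonneg fun _ _ => Finset.sum_nonneg fun _ _ => by positivity
  set c : ℝ := 3 + (1 + R) ^ N with hc
  have hc0 : 0 < c := by positivity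
  set e : ℝ := ε / c with he
  have he0 : 0 < e := div_pos hε hc0
  have hec : 3 * e + (1 + R) ^ N * e = ε := by
    rw [← add_mul, ← hc, he, mul_div_cancel₀ _ hc0.ne']
  have hRe : 0 ≤ (1 + R) ^ N * e := by positivity
  obtain ⟨v, G, U₁, U₂, hv, hGb, o1, o2, hd, s1, s2, g1, g2, -, hm⟩ :=
    exists_rankOne_perturbation hU hb a b hl he0 hα
  have b1 := hb.subset s1
  have b2 := hb.subset s2
  obtain ⟨v₁, G₁, B₁, hv₁, mB₁, sB₁, hK₁, hi₁, ht₁⟩ := h₁ U₁ o1 b1 e he0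
  obtain ⟨v₂, G₂, B₂, hv₂, mB₂, sB₂, hK₂, hi₂, ht₂⟩ := h₂ U₂ o2 b2 e he0
  have e1 : ∀ x ∈ U₁, X + (G x + G₁ x + G₂ x) = X₁ + G₁ x := fun x hx => by
    rw [hv₂.grad_eq_zero x (disjoint_left.1 hd hx), g1 x hx, ← hab, hX]
    module
  have e2 : ∀ x ∈ U₂, X + (G x + G₁ x + G₂ x) = X₂ + G₂ x := fun x hx => by
    rw [hv₁.grad_eq_zero x (disjoint_right.1 hd hx), g2 x hx, ← hab, hX]
    module
  set E := U \ (U₁ ∪ U₂) with hE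
  have mE : MeasurableSet E := hU.measurableSet.diff (o1.union o2).measurableSet
  have e3 : ∀ x ∈ E, frobNorm (X + (G x + G₁ x + G₂ x)) ≤ R := fun x hx => by
    rw [hv₁.grad_eq_zero x fun h => hx.2 (Or.inl h), hv₂.grad_eq_zero x fun h => hx.2 (Or.inr h),
      add_zero, add_zero]
    refine (frobNorm_le_sum_abs _).trans (Finset.sum_le_sum fun k _ => Finset.sum_le_sum fun i _ => ?_)
    exact (abs_add_le _ _).trans (add_le_add le_rfl (hGb x k i))
  refine ⟨fun x => v x + v₁ x + v₂ x, fun x => G x + G₁ x + G₂ x, B₁ ∪ B₂ ∪ E,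
    ((hv.add (hv₁.mono le_rfl s1)).add (hv₂.mono le_rfl s2)).mono (by linarith) subset_rfl,
    (mB₁.union mB₂).union mE, ?_, ?_, ?_, fun t ht => ?_⟩
  · exact union_subset (union_subset (sB₁.trans s1) (sB₂.trans s2)) sdiff_subset
  · rintro x ⟨hxU, hx⟩
    simp only [mem_union, not_or] at hx
    obtain ⟨⟨hx1, hx2⟩, hx3⟩ := hx
    have : x ∈ U₁ ∪ U₂ := by
      by_contra h
      exact hx3 ⟨hxU, h⟩
    rcases this with h | h
    · beta_reduce; rw [e1 x h]; exact hK₁ x ⟨h, hx1⟩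
    · beta_reduce; rw [e2 x h]; exact hK₂ x ⟨h, hx2⟩
  · refine (lintegral_union_le _ _ _).trans ((add_le_add (lintegral_union_le _ _ _) le_rfl).trans ?_)
    rw [setLIntegral_congr_fun (g := fun x => ENNReal.ofReal ((1 + frobNorm (X₁ + G₁ x)) ^ N)) mB₁
        (fun x hx => by beta_reduce; rw [e1 x (sB₁ hx)]),
      setLIntegral_congr_fun (g := fun x => ENNReal.ofReal ((1 + frobNorm (X₂ + G₂ x)) ^ N)) mB₂
        (fun x hx => by beta_reduce; rw [e2 x (sB₂ hx)])]
    calc _ ≤ ENNReal.ofReal e + ENNReal.ofReal e + ENNReal.ofReal ((1 + R) ^ N * e) :=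
          add_le_add (add_le_add hi₁ hi₂) (lintegral_one_add_frobNorm_pow_le mE
            (hb.subset sdiff_subset).measure_lt_top.ne hR0 e3 hm N)
      _ = ENNReal.ofReal (e + e + (1 + R) ^ N * e) := by
          rw [← ENNReal.ofReal_add he0.le he0.le, ← ENNReal.ofReal_add (by linarith) hRe]
      _ ≤ ENNReal.ofReal ε := ENNReal.ofReal_le_ofReal (by linarith)
  · have hsub : {x ∈ U \ (B₁ ∪ B₂ ∪ E) | t < frobNorm (X + (G x + G₁ x + G₂ x))} ⊆
        {x ∈ U₁ \ B₁ | t < frobNorm (X₁ + G₁ x)} ∪ {x ∈ U₂ \ B₂ | t < frobNorm (X₂ + G₂ x)} := by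
      rintro x ⟨⟨hxU, hx⟩, hxt⟩
      simp only [mem_union, not_or] at hx
      obtain ⟨⟨hx1, hx2⟩, hx3⟩ := hx
      have : x ∈ U₁ ∪ U₂ := by
        by_contra h
        exact hx3 ⟨hxU, h⟩
      rcases this with h | h
      · rw [e1 x h] at hxt; exact Or.inl ⟨⟨h, hx1⟩, hxt⟩
      · rw [e2 x h] at hxt; exact Or.inr ⟨⟨h, hx2⟩, hxt⟩
    have hvol : volume.real U₁ + volume.real U₂ ≤ volume.real U := by
      rw [← measureReal_union hd o2.measurableSet b1.measure_lt_top.ne b2.measure_lt_top.ne]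
      exact measureReal_mono (union_subset s1 s2) hb.measure_lt_top.ne
    have hfin : volume ({x ∈ U₁ \ B₁ | t < frobNorm (X₁ + G₁ x)} ∪
        {x ∈ U₂ \ B₂ | t < frobNorm (X₂ + G₂ x)}) ≠ ⊤ :=
      (hb.subset (union_subset (fun x hx => s1 hx.1.1) fun x hx => s2 hx.1.1)).measure_lt_top.ne
    calc _ ≤ (volume.real {x ∈ U₁ \ B₁ | t < frobNorm (X₁ + G₁ x)} +
            volume.real {x ∈ U₂ \ B₂ | t < frobNorm (X₂ + G₂ x)}) * t ^ m := by
          gcongr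
          exact (measureReal_mono hsub hfin).trans (measureReal_union_le _ _)
      _ ≤ C * volume.real U₁ + e + (C * volume.real U₂ + e) := by
          rw [add_mul]; exact add_le_add (ht₁ t ht) (ht₂ t ht)
      _ ≤ C * volume.real U + ε := by
          have := mul_le_mul_of_nonneg_left hvol hC
          linarith

end

/-- The open sets, perturbations and gradients obtained by iterating a splitting construction. -/
lemma exists_nested_perturbations [Fintype ι] [DecidableEq ι] {α : ℝ} (hα : α ∈ Ico (0 : ℝ) 1)
    {U : Set (ι → ℝ)} (hU : IsOpen U) (hb : Bornology.IsBounded U) (a b : ℕ → ι → ℝ) {p e : ℕ → ℝ}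
    (hp : ∀ k, p k ∈ Ioo (0 : ℝ) 1) (he : ∀ k, 0 < e k) :
    ∃ (V W : ℕ → Set (ι → ℝ)) (v : ℕ → (ι → ℝ) → ι → ℝ) (G : ℕ → (ι → ℝ) → Matrix ι ι ℝ),
      V 0 = U ∧ (∀ k, IsOpen (V k)) ∧ (∀ k, IsOpen (W k)) ∧ (∀ k, V (k + 1) ⊆ V k) ∧
      (∀ k, IsPerturbation α (e k) (V k) (v k) (G k)) ∧
      (∀ k x r i, |G k x r i| ≤ |a k r| * (|b k i| + 1)) ∧
      (∀ k, ∀ x ∈ V (k + 1), G k x = (1 - p k) • Matrix.vecMulVec (a k) (b k)) ∧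
      (∀ k, ∀ x ∈ W k, G k x = -p k • Matrix.vecMulVec (a k) (b k)) ∧
      (∀ k, volume.real (V (k + 1)) ≤ p k * volume.real (V k) + e k) ∧
      ∀ k, volume.real (V k \ (V (k + 1) ∪ W k)) ≤ e k := by
  have step : ∀ (k : ℕ) (S : {S : Set (ι → ℝ) // IsOpen S ∧ Bornology.IsBounded S}),
      ∃ (v : (ι → ℝ) → ι → ℝ) (G : (ι → ℝ) → Matrix ι ι ℝ)
        (T : {S : Set (ι → ℝ) // IsOpen S ∧ Bornology.IsBounded S}) (W : Set (ι → ℝ)),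
      IsPerturbation α (e k) S v G ∧ (∀ x r i, |G x r i| ≤ |a k r| * (|b k i| + 1)) ∧
      IsOpen W ∧ T.1 ⊆ S.1 ∧
      (∀ x ∈ T.1, G x = (1 - p k) • Matrix.vecMulVec (a k) (b k)) ∧
      (∀ x ∈ W, G x = -p k • Matrix.vecMulVec (a k) (b k)) ∧
      volume.real T.1 ≤ p k * volume.real S.1 + e k ∧ volume.real (S.1 \ (T.1 ∪ W)) ≤ e k := by
    rintro k ⟨S, hS, hSb⟩
    obtain ⟨v, G, T, W, h1, h2, h3, h4, -, h6, -, h8, h9, h10, h11⟩ :=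
      exists_rankOne_perturbation hS hSb (a k) (b k) (hp k) (he k) hα
    exact ⟨v, G, ⟨T, h3, hSb.subset h6⟩, W, h1, h2, h4, h6, h8, h9, h10, h11⟩
  choose v G T W h1 h2 h3 h4 h5 h6 h7 h8 using step
  let V : ℕ → {S : Set (ι → ℝ) // IsOpen S ∧ Bornology.IsBounded S} :=
    fun k => Nat.rec ⟨U, hU, hb⟩ (fun k S => T k S) k
  exact ⟨fun k => (V k).1, fun k => W k (V k), fun k => v k (V k), fun k => G k (V k), rfl,
    fun k => (V k).2.1, fun k => h3 k _, fun k => h4 k _, fun k => h1 k _, fun k => h2 k _,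
    fun k => h5 k _, fun k => h6 k _, fun k => h7 k _, fun k => h8 k _⟩

/-- An infinite staircase of splittings yields admissibility of its starting point. -/
lemma admissible_of_staircase [Fintype ι] [DecidableEq ι] {α : ℝ} (hα : α ∈ Ico (0 : ℝ) 1)
    {N m : ℕ} {K : Set (Matrix ι ι ℝ)} {Y Z : ℕ → Matrix ι ι ℝ} {a b : ℕ → ι → ℝ} {p D : ℕ → ℝ}
    {c : ℝ} (hc : 0 ≤ c) (hp : ∀ k, p k ∈ Ioo (0 : ℝ) 1)
    (hY : ∀ k, Y k = (1 - p k) • Z k + p k • Y (k + 1))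
    (hab : ∀ k, Y (k + 1) - Z k = Matrix.vecMulVec (a k) (b k)) (hZ : ∀ k, Z k ∈ K)
    (hD : ∀ k, 0 < D k) (hpD : ∀ k, p k * D (k + 1) ≤ D k) (hDtop : Tendsto D atTop atTop)
    (hZD : ∀ k, frobNorm (Z k) ^ m ≤ c * D k)
    (hs : Summable fun k => (∑ r, ∑ i, |a k r| * (|b k i| + 1)) / D k) :
    Admissible α N m K (c * D 0) (Y 0) := by
  intro U hU hb ε hε
  set R : ℕ → ℝ := fun k => ∑ r, ∑ i, |a k r| * (|b k i| + 1) with hR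
  have hR0 : ∀ k, 0 ≤ R k := fun k =>
    Finset.sum_nonneg fun _ _ => Finset.sum_nonneg fun _ _ => by positivity
  set r : ℕ → ℝ := fun k => ∑ j, ∑ i, (|Y k j i| + |a k j| * (|b k i| + 1)) with hr
  have hr0 : ∀ k, 0 ≤ r k := fun k =>
    Finset.sum_nonneg fun _ _ => Finset.sum_nonneg fun _ _ => by positivity
  set d : ℝ := ε / (1 + c) with hd
  have hd0 : 0 < d := by positivity
  have hdε : d ≤ ε := div_le_self hε.le (by linarith)
  have hcd : c * d ≤ ε := by
    rw [hd, mul_div_assoc', div_le_iff₀ (by positivity)]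
    nlinarith
  set g : ℕ → ℝ := fun k => d / 2 / 2 ^ k with hg
  have hg0 : ∀ k, 0 < g k := fun k => by positivity
  have hgs : HasSum g d := hasSum_geometric_two' d
  set q : ℕ → ℝ := fun k => 1 + D (k + 1) + (1 + r k) ^ N with hq
  have hrN : ∀ k, 0 ≤ (1 + r k) ^ N := fun k => by have := hr0 k; positivity
  have hq1 : ∀ k, 1 ≤ q k := fun k => by
    have := hD (k + 1)
    have := hrN k
    simp only [hq]; linarith
  set e : ℕ → ℝ := fun k => g k / q k with he
  have he0 : ∀ k, 0 < e k := fun k => div_pos (hg0 k) (by linarith [hq1 k])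
  have heq : ∀ k, e k * q k = g k := fun k => div_mul_cancel₀ _ (by linarith [hq1 k])
  have heg : ∀ k, e k ≤ g k := fun k => div_le_self (hg0 k).le (hq1 k)
  have heD : ∀ k, e k * D (k + 1) ≤ g k := fun k => by
    rw [← heq k]
    refine mul_le_mul_of_nonneg_left ?_ (he0 k).le
    simp only [hq]; linarith [hrN k]
  have heN : ∀ k, (1 + r k) ^ N * e k ≤ g k := fun k => by
    rw [← heq k, mul_comm]
    refine mul_le_mul_of_nonneg_left ?_ (he0 k).le
    simp only [hq]; linarith [hD (k + 1)]
  obtain ⟨V, W, v, G, hV0, oV, oW, hVV, hv, hGb, hGV, hGW, hmV, hmE⟩ :=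
    exists_nested_perturbations hα hU hb a b hp he0
  have hanti : Antitone V := antitone_nat_of_succ_le hVV
  have hVU : ∀ k, V k ⊆ U := fun k => hV0 ▸ hanti (Nat.zero_le k)
  have hVb : ∀ k, Bornology.IsBounded (V k) := fun k => hb.subset (hVU k)
  have hVD : ∀ k, volume.real (V k) * D k ≤ volume.real U * D 0 + ∑ j ∈ Finset.range k, g j := by
    intro k
    induction k with
    | zero => simp [hV0]
    | succ k ih =>
      rw [Finset.sum_range_succ]
      have h1 := mul_le_mul_of_nonneg_right (hmV k) (hD (k + 1)).le
      have h2 := mul_le_mul_of_nonneg_left (hpD k) (measureReal_nonneg (μ := volume) (s := V k))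
      have h3 := heD k
      nlinarith
  have hVD' : ∀ k, volume.real (V k) * D k ≤ volume.real U * D 0 + d := fun k =>
    (hVD k).trans (by gcongr; exact sum_le_hasSum _ (fun j _ => (hg0 j).le) hgs)
  have hGint : ∀ s i, Summable fun k => ∫ x, |G k x s i| := by
    intro s i
    refine Summable.of_nonneg_of_le (fun k => integral_nonneg fun x => abs_nonneg _) (fun k => ?_)
      (hs.mul_left (volume.real U * D 0 + d))
    have h1 : ∫ x, |G k x s i| = ∫ x in V k, |G k x s i| := by
      refine (setIntegral_eq_integral_of_forall_compl_eq_zero fun x hx => ?_).symm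
      rw [(hv k).grad_eq_zero x hx]; simp
    have h2 : ∫ x in V k, |G k x s i| ≤ R k * volume.real (V k) := by
      refine (Real.le_norm_self _).trans (norm_setIntegral_le_of_norm_le_const
        (hVb k).measure_lt_top fun x _ => ?_)
      rw [Real.norm_eq_abs, abs_abs]
      refine (hGb k x s i).trans ?_
      refine (Finset.single_le_sum (f := fun i => |a k s| * (|b k i| + 1))
        (fun i _ => by positivity) (Finset.mem_univ i)).trans ?_
      exact Finset.single_le_sum (f := fun s => ∑ i, |a k s| * (|b k i| + 1))
        (fun s _ => Finset.sum_nonneg fun _ _ => by positivity) (Finset.mem_univ s)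
    rw [h1]
    refine h2.trans ?_
    rw [mul_div_assoc', le_div_iff₀ (hD k)]
    have := mul_le_mul_of_nonneg_left (hVD' k) (hR0 k)
    calc R k * volume.real (V k) * D k = R k * (volume.real (V k) * D k) := by ring
      _ ≤ R k * (volume.real U * D 0 + d) := this
      _ = _ := mul_comm _ _
  have hpert := IsPerturbation.tsum (fun k => (hv k).mono (heg k) (hVU k)) hgs hGint
  set H : (ι → ℝ) → Matrix ι ι ℝ := fun x => Matrix.of fun s i => ∑' j, G j x s i with hH
  have hGY : ∀ k, ∀ x ∈ V (k + 1), G k x = Y (k + 1) - Y k := fun k x hx => by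
    rw [hGV k x hx, ← hab k, hY k]
    module
  have hsumY : ∀ k, ∀ x ∈ V k, ∑ j ∈ Finset.range k, G j x = Y k - Y 0 := fun k x hx => by
    rw [← Finset.sum_range_sub]
    refine Finset.sum_congr rfl fun j hj => hGY j x (hanti ?_ hx)
    exact Finset.mem_range.1 hj
  have hHx : ∀ k, ∀ x ∈ V k \ V (k + 1), Y 0 + H x = Y k + G k x := fun k x hx => by
    have h1 : H x = ∑ j ∈ Finset.range (k + 1), G j x := by
      ext s i
      simp only [hH, Matrix.of_apply, Matrix.sum_apply]
      refine tsum_eq_sum fun j hj => ?_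
      have hj' : k + 1 ≤ j := by simpa using hj
      rw [(hv j).grad_eq_zero x fun h => hx.2 (hanti hj' h)]
      rfl
    rw [h1, Finset.sum_range_succ, hsumY k x hx.1]
    abel
  have hHW : ∀ k, ∀ x ∈ V k \ V (k + 1), x ∈ W k → Y 0 + H x = Z k := fun k x hx hxW => by
    rw [hHx k x hx, hGW k x hxW, ← hab k, hY k]
    module
  set E : ℕ → Set (ι → ℝ) := fun k => V k \ (V (k + 1) ∪ W k) with hE
  have mE : ∀ k, MeasurableSet (E k) := fun k =>
    (oV k).measurableSet.diff ((oV _).union (oW k)).measurableSet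
  have hHE : ∀ k, ∀ x ∈ E k, frobNorm (Y 0 + H x) ≤ r k := fun k x hx => by
    rw [hHx k x ⟨hx.1, fun h => hx.2 (Or.inl h)⟩]
    refine (frobNorm_le_sum_abs _).trans (Finset.sum_le_sum fun s _ => Finset.sum_le_sum fun i _ => ?_)
    exact (abs_add_le _ _).trans (add_le_add le_rfl (hGb k x s i))
  have hnull : volume (⋂ k, V k) = 0 := by
    have hfin : volume (⋂ k, V k) ≠ ⊤ := ((hVb 0).subset (iInter_subset V 0)).measure_lt_top.ne
    rw [← measureReal_eq_zero_iff hfin]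
    refine le_antisymm ?_ measureReal_nonneg
    refine ge_of_tendsto' ((tendsto_const_nhds (x := volume.real U * D 0 + d)).div_atTop hDtop)
      fun k => ?_
    rw [le_div_iff₀ (hD k)]
    refine le_trans ?_ (hVD' k)
    exact mul_le_mul_of_nonneg_right (measureReal_mono (iInter_subset V k)
      (hVb k).measure_lt_top.ne) (hD k).le
  have hlevel : ∀ x ∈ U \ ((⋃ k, E k) ∪ ⋂ k, V k), ∃ k, x ∈ V k \ V (k + 1) ∧ x ∈ W k := by
    rintro x ⟨hxU, hx⟩
    simp only [mem_union, mem_iUnion, mem_iInter, not_or, not_exists, not_forall] at hx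
    obtain ⟨hxE, hxV⟩ := hx
    classical
    obtain ⟨k, hk⟩ : ∃ k, Nat.find hxV = k + 1 := by
      refine Nat.exists_eq_succ_of_ne_zero fun h => ?_
      have := Nat.find_spec hxV
      rw [h, hV0] at this
      exact this hxU
    have h1 : x ∉ V (k + 1) := hk ▸ Nat.find_spec hxV
    have h2 : x ∈ V k := not_not.1 (Nat.find_min hxV (by omega))
    refine ⟨k, ⟨h2, h1⟩, ?_⟩
    by_contra h3
    exact hxE k ⟨h2, fun h => h.elim h1 h3⟩
  refine ⟨_, H, (⋃ k, E k) ∪ ⋂ k, V k, hpert.mono hdε subset_rfl,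
    (MeasurableSet.iUnion mE).union (MeasurableSet.iInter fun k => (oV k).measurableSet), ?_, ?_, ?_,
    fun t ht => ?_⟩
  · exact union_subset (iUnion_subset fun k => sdiff_subset.trans (hVU k))
      ((iInter_subset V 0).trans (hVU 0))
  · intro x hx
    obtain ⟨k, hk, hkW⟩ := hlevel x hx
    rw [hHW k x hk hkW]
    exact hZ k
  · refine (lintegral_union_le _ _ _).trans ?_
    rw [setLIntegral_measure_zero _ _ hnull, add_zero]
    refine (lintegral_iUnion_le _ _).trans ?_
    calc _ ≤ ∑' k, ENNReal.ofReal (g k) := ENNReal.tsum_le_tsum fun k =>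
          (lintegral_one_add_frobNorm_pow_le (mE k)
            ((hVb k).subset sdiff_subset).measure_lt_top.ne (hr0 k) (hHE k) (hmE k) N).trans
            (ENNReal.ofReal_le_ofReal (heN k))
      _ = ENNReal.ofReal d := by
          rw [← ENNReal.ofReal_tsum_of_nonneg (fun k => (hg0 k).le) hgs.summable, hgs.tsum_eq]
      _ ≤ ENNReal.ofReal ε := ENNReal.ofReal_le_ofReal hdε
  · have hrhs : 0 ≤ c * D 0 * volume.real U + ε := by
      have := hD 0
      positivity
    by_cases hex : ∃ k, t < frobNorm (Z k)
    · classical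
      set k := Nat.find hex with hk
      have hkt : t < frobNorm (Z k) := Nat.find_spec hex
      have hsub : {x ∈ U \ ((⋃ k, E k) ∪ ⋂ k, V k) | t < frobNorm (Y 0 + H x)} ⊆ V k := by
        rintro x ⟨hx, hxt⟩
        obtain ⟨l, hl, hlW⟩ := hlevel x hx
        rw [hHW l x hl hlW] at hxt
        exact hanti (Nat.find_min' hex hxt) hl.1
      have h1 := measureReal_mono (μ := volume) hsub (hVb k).measure_lt_top.ne
      have h2 : t ^ m ≤ c * D k := (by gcongr : t ^ m ≤ frobNorm (Z k) ^ m).trans (hZD k)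
      calc _ ≤ volume.real (V k) * (c * D k) := by gcongr
        _ = c * (volume.real (V k) * D k) := by ring
        _ ≤ c * (volume.real U * D 0 + d) := mul_le_mul_of_nonneg_left (hVD' k) hc
        _ ≤ c * D 0 * volume.real U + ε := by linarith
    · have : {x ∈ U \ ((⋃ k, E k) ∪ ⋂ k, V k) | t < frobNorm (Y 0 + H x)} = ∅ := by
        refine eq_empty_of_forall_notMem fun x hx => ?_
        obtain ⟨l, hl, hlW⟩ := hlevel x hx.1
        have := hx.2
        rw [hHW l x hl hlW] at this
        exact hex ⟨l, this⟩
      rw [this]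
      simpa using hrhs

section

variable [DecidableEq ι]

/-- The matrix whose row `k` has the single entry `y k`, in column `π k`. -/
def monomialMatrix (π : Equiv.Perm ι) (y : ι → ℝ) : Matrix ι ι ℝ :=
  Matrix.of fun k l => if π k = l then y k else 0

lemma monomialMatrix_apply (π : Equiv.Perm ι) (y : ι → ℝ) (k l : ι) :
    monomialMatrix π y k l = if π k = l then y k else 0 := rfl

lemma monomialMatrix_update_sub (π : Equiv.Perm ι) (y : ι → ℝ) (i : ι) (s t : ℝ) :
    monomialMatrix π (Function.update y i s) - monomialMatrix π (Function.update y i t) =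
      Matrix.vecMulVec (Pi.single i 1) (Pi.single (π i) (s - t)) := by
  ext k l
  simp only [Matrix.sub_apply, monomialMatrix_apply, Matrix.vecMulVec_apply]
  by_cases hk : k = i
  · subst hk
    by_cases hl : π k = l
    · subst hl; simp
    · simp [hl, Ne.symm hl]
  · simp [hk]

lemma monomialMatrix_update_combine (π : Equiv.Perm ι) (y : ι → ℝ) (i : ι) (s t l : ℝ) :
    l • monomialMatrix π (Function.update y i s) +
      (1 - l) • monomialMatrix π (Function.update y i t) =
      monomialMatrix π (Function.update y i (l * s + (1 - l) * t)) := by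
  ext k j
  simp only [Matrix.add_apply, Matrix.smul_apply, monomialMatrix_apply, smul_eq_mul]
  by_cases hk : k = i
  · subst hk
    by_cases hl : π k = j
    · simp [hl]
    · simp [hl]
  · by_cases hl : π k = j
    · simp [hl, hk]; ring
    · simp [hl]

variable [Fintype ι]

lemma det_monomialMatrix (π : Equiv.Perm ι) (y : ι → ℝ) :
    (monomialMatrix π y).det = (Equiv.Perm.sign π : ℤ) * ∏ i, y i := by
  have : monomialMatrix π y = (Matrix.diagonal y).submatrix id (π⁻¹ : Equiv.Perm ι) := by
    ext k l
    simp [monomialMatrix_apply, Matrix.diagonal_apply, Equiv.eq_symm_apply]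
  rw [this, Matrix.det_permute', Matrix.det_diagonal, Equiv.Perm.sign_inv]

lemma sum_abs_monomialMatrix (π : Equiv.Perm ι) (y : ι → ℝ) :
    ∑ k, ∑ l, |monomialMatrix π y k l| = ∑ k, |y k| := by
  refine Finset.sum_congr rfl fun k _ => ?_
  rw [Finset.sum_eq_single (π k)]
  · simp [monomialMatrix_apply]
  · intro l _ hl
    simp [monomialMatrix_apply, hl.symm]
  · simp

lemma prod_update_mul (y : ι → ℝ) (i : ι) (s : ℝ) :
    ∏ j, Function.update y i (s * y i) j = s * ∏ j, y j := by
  rw [Finset.prod_update_of_mem (Finset.mem_univ i), ← Finset.mul_prod_erase _ _ (Finset.mem_univ i),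
    Finset.sdiff_singleton_eq_erase, mul_assoc]

/-- Vectors of moduli at least two, comparable up to a factor two, growing by doubling the
coordinate of least modulus. -/
lemma exists_doubling_sequence [Nonempty ι] {y₀ : ι → ℝ} (h₀ : ∀ i, 2 ≤ |y₀ i|)
    (h₁ : ∀ i j, |y₀ i| ≤ 2 * |y₀ j|) :
    ∃ (y : ℕ → ι → ℝ) (i : ℕ → ι), y 0 = y₀ ∧
      (∀ k, y (k + 1) = Function.update (y k) (i k) (2 * y k (i k))) ∧ (∀ k j, 2 ≤ |y k j|) ∧
      (∀ k j, |y k (i k)| ≤ |y k j|) ∧ ∀ k j, |y k j| ≤ 2 * |y k (i k)| := by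
  choose i hi using fun y : ι → ℝ => Finite.exists_min fun j => |y j|
  let y : ℕ → ι → ℝ := fun k =>
    Nat.rec y₀ (fun _ y => Function.update y (i y) (2 * y (i y))) k
  have hy : ∀ k, y (k + 1) = Function.update (y k) (i (y k)) (2 * y k (i (y k))) := fun k => rfl
  have key : ∀ k, (∀ j, 2 ≤ |y k j|) ∧ ∀ j l, |y k j| ≤ 2 * |y k l| := by
    intro k
    induction k with
    | zero => exact ⟨h₀, h₁⟩
    | succ k ih =>
      obtain ⟨ih1, ih2⟩ := ih
      have hnew : |2 * y k (i (y k))| = 2 * |y k (i (y k))| := by rw [abs_mul, abs_two]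
      constructor
      · intro j
        rw [hy]
        by_cases hj : j = i (y k)
        · subst hj
          rw [Function.update_self, hnew]
          linarith [ih1 (i (y k))]
        · rw [Function.update_of_ne hj]; exact ih1 j
      · intro j l
        rw [hy]
        have a1 := hi (y k) j
        have a2 := hi (y k) l
        have a3 := ih2 j (i (y k))
        have a4 := ih2 j l
        have a5 := abs_nonneg (y k (i (y k)))
        by_cases hj : j = i (y k)
        · subst hj
          rw [Function.update_self, hnew]
          by_cases hl : l = i (y k)
          · subst hl
            rw [Function.update_self, hnew]
            linarith
          · rw [Function.update_of_ne hl]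
            linarith
        · rw [Function.update_of_ne hj]
          by_cases hl : l = i (y k)
          · subst hl
            rw [Function.update_self, hnew]
            linarith
          · rw [Function.update_of_ne hl]
            linarith
  exact ⟨y, fun k => i (y k), rfl, hy, fun k => (key k).1, fun k => hi (y k),
    fun k j => (key k).2 j _⟩

lemma staircase_weight_mem {q : ℝ} (hq : 2 ≤ |q|) : (q - 1) / (2 * q - 1) ∈ Ioo (0 : ℝ) 1 := by
  rcases le_abs'.1 hq with h | h
  · rw [← neg_div_neg_eq]
    exact ⟨div_pos (by linarith) (by linarith), (div_lt_one (by linarith)).2 (by linarith)⟩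
  · exact ⟨div_pos (by linarith) (by linarith), (div_lt_one (by linarith)).2 (by linarith)⟩

lemma staircase_weight_combine {q : ℝ} (hq : q ≠ 0) (hq' : 2 * q - 1 ≠ 0) (w : ℝ) :
    (q - 1) / (2 * q - 1) * (2 * w) + (1 - (q - 1) / (2 * q - 1)) * (q⁻¹ * w) = w := by
  have h : 1 - (q - 1) / (2 * q - 1) = q / (2 * q - 1) := by
    rw [eq_div_iff hq', sub_mul, div_mul_cancel₀ _ hq']; ring
  rw [h, div_mul_eq_mul_div, div_mul_eq_mul_div, ← add_div, mul_inv_cancel_left₀ hq,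
    div_eq_iff hq']
  ring

/-- Monomial matrices with entries of equal modulus start a staircase. -/
lemma admissible_monomialMatrix_of_abs_eq {α : ℝ} (hα : α ∈ Ico (0 : ℝ) 1) {N m : ℕ}
    (hm : Fintype.card ι = m) (hm2 : 2 ≤ m) {K : Set (Matrix ι ι ℝ)} {π : Equiv.Perm ι}
    (hK : ∀ y, (monomialMatrix π y).det = 1 → monomialMatrix π y ∈ K) {x : ℝ} (hx : 2 ≤ x)
    {y₀ : ι → ℝ} (hy₀ : ∀ i, |y₀ i| = x) :
    Admissible α N m K (4 * (2 * m) ^ m * x ^ m) (monomialMatrix π y₀) := by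
  have hne : Nonempty ι := Fintype.card_pos_iff.1 (by omega)
  obtain ⟨y, i, hy0, hy, hy2, hymin, hymax⟩ := exists_doubling_sequence (y₀ := y₀)
    (fun i => (hy₀ i).symm ▸ hx) (fun i j => by rw [hy₀, hy₀]; linarith)
  set s : ℝ := ((Equiv.Perm.sign π : ℤ) : ℝ) with hs
  have hs1 : |s| = 1 := by
    rcases Int.units_eq_one_or (Equiv.Perm.sign π) with h | h <;> simp [hs, h]
  set q : ℕ → ℝ := fun k => s * ∏ j, y k j with hq
  have hq2 : ∀ k, q (k + 1) = 2 * q k := fun k => by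
    simp only [hq, hy k, prod_update_mul]; ring
  have hqabs : ∀ k, |q k| = ∏ j, |y k j| := fun k => by
    simp only [hq]; rw [abs_mul, hs1, one_mul, Finset.abs_prod]
  have hqpow : ∀ k, q k = 2 ^ k * q 0 := fun k => by
    induction k with
    | zero => simp
    | succ k ih => rw [hq2, ih, pow_succ]; ring
  have hq0 : |q 0| = x ^ m := by
    rw [hqabs, hy0, Finset.prod_congr rfl fun j _ => hy₀ j, Finset.prod_const, Finset.card_univ, hm]
  have hminq : ∀ k, |y k (i k)| ^ m ≤ |q k| := fun k => by
    rw [hqabs, ← hm, ← Finset.card_univ, ← Finset.prod_const]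
    exact Finset.prod_le_prod (fun _ _ => abs_nonneg _) fun j _ => hymin k j
  have hsqq : ∀ k, |y k (i k)| ^ 2 ≤ |q k| := fun k =>
    (pow_le_pow_right₀ (by linarith [hy2 k (i k)]) hm2).trans (hminq k)
  have hq4 : ∀ k, 4 ≤ |q k| := fun k => by
    have := hy2 k (i k)
    nlinarith [hsqq k]
  have hqne : ∀ k, q k ≠ 0 := fun k h => by
    have := hq4 k
    rw [h, abs_zero] at this
    linarith
  set D : ℕ → ℝ := fun k => |1 - q k| with hD
  have hDlow : ∀ k, |q k| / 2 ≤ D k := fun k => by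
    have h1 := abs_sub_abs_le_abs_sub (q k) 1
    rw [abs_one, abs_sub_comm] at h1
    have := hq4 k
    simp only [hD]; linarith
  have hDup : D 0 ≤ 2 * x ^ m := by
    have h1 := abs_sub (1 : ℝ) (q 0)
    rw [abs_one, hq0] at h1
    have := hq4 0
    rw [hq0] at this
    simp only [hD]; linarith
  set z : ℕ → ι → ℝ := fun k => Function.update (y k) (i k) ((q k)⁻¹ * y k (i k)) with hz
  have h2q : ∀ k, 2 * q k - 1 ≠ 0 := fun k h => by
    have : q k = 1 / 2 := by linarith
    have h4 := hq4 k
    rw [this] at h4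
    norm_num [abs_of_pos] at h4
  have hzabs : ∀ k j, |z k j| ≤ 2 * |y k (i k)| := fun k j => by
    simp only [hz]
    by_cases hj : j = i k
    · subst hj
      rw [Function.update_self, abs_mul, abs_inv]
      have : |q k|⁻¹ ≤ 1 := inv_le_one_of_one_le₀ (by linarith [hq4 k])
      nlinarith [abs_nonneg (y k (i k))]
    · rw [Function.update_of_ne hj]
      exact hymax k j
  have hadm : Admissible α N m K ((2 * (2 * m) ^ m) * D 0) (monomialMatrix π (y 0)) := by
    refine admissible_of_staircase hα (Y := fun k => monomialMatrix π (y k))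
      (Z := fun k => monomialMatrix π (z k)) (a := fun k => Pi.single (i k) 1)
      (b := fun k => Pi.single (π (i k)) (2 * y k (i k) - (q k)⁻¹ * y k (i k)))
      (p := fun k => (q k - 1) / (2 * q k - 1)) (by positivity)
      (fun k => staircase_weight_mem (by linarith [hq4 k])) (fun k => ?_) (fun k => ?_) (fun k => ?_)
      (fun k => ?_) (fun k => ?_) ?_ (fun k => ?_) ?_
    · rw [hy k, add_comm]
      have := monomialMatrix_update_combine π (y k) (i k) (2 * y k (i k)) ((q k)⁻¹ * y k (i k))
        ((q k - 1) / (2 * q k - 1))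
      rw [this]
      have h3 : (q k - 1) / (2 * q k - 1) * (2 * y k (i k)) +
          (1 - (q k - 1) / (2 * q k - 1)) * ((q k)⁻¹ * y k (i k)) = y k (i k) := by
        exact staircase_weight_combine (hqne k) (h2q k) _
      rw [h3, Function.update_eq_self]
    · rw [hy k]
      exact monomialMatrix_update_sub π (y k) (i k) _ _
    · refine hK _ ?_
      rw [det_monomialMatrix]
      simp only [hz, prod_update_mul]
      rw [mul_left_comm]
      exact inv_mul_cancel₀ (hqne k)
    · linarith [hDlow k, hq4 k]
    · simp only [hD, hq2]
      rw [← abs_of_pos (staircase_weight_mem (q := q k) (by linarith [hq4 k])).1, ← abs_mul,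
        abs_sub_comm 1 (q k), ← neg_sub (2 * q k) 1, mul_neg, abs_neg, div_mul_cancel₀ _ (h2q k)]
    · refine tendsto_atTop_mono (f := fun k => (2 : ℝ) ^ k) (fun k => ?_)
        (tendsto_pow_atTop_atTop_of_one_lt one_lt_two)
      refine le_trans ?_ (hDlow k)
      rw [hqpow k, abs_mul, abs_of_pos (by positivity : (0 : ℝ) < 2 ^ k)]
      have := hq4 0
      have : (0 : ℝ) < 2 ^ k := by positivity
      nlinarith
    · have h1 : frobNorm (monomialMatrix π (z k)) ≤ 2 * m * |y k (i k)| := by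
        refine (frobNorm_le_sum_abs _).trans ?_
        rw [sum_abs_monomialMatrix]
        refine (Finset.sum_le_sum fun j _ => hzabs k j).trans ?_
        rw [Finset.sum_const, Finset.card_univ, hm, nsmul_eq_mul]
        linarith
      calc frobNorm (monomialMatrix π (z k)) ^ m ≤ (2 * m * |y k (i k)|) ^ m :=
            pow_le_pow_left₀ (frobNorm_nonneg _) h1 m
        _ = (2 * m) ^ m * |y k (i k)| ^ m := mul_pow _ _ _
        _ ≤ (2 * m) ^ m * (2 * D k) := by
            gcongr
            linarith [hminq k, hDlow k]
        _ = _ := by ring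
    · have hR : ∀ k, (∑ r, ∑ j, |(Pi.single (i k) 1 : ι → ℝ) r| *
          (|(Pi.single (π (i k)) (2 * y k (i k) - (q k)⁻¹ * y k (i k)) : ι → ℝ) j| + 1)) =
            |2 * y k (i k) - (q k)⁻¹ * y k (i k)| + m := fun k => by
        rw [Finset.sum_eq_single (i k)]
        · simp only [Pi.single_eq_same, abs_one, one_mul, Finset.sum_add_distrib, Finset.sum_const,
            Finset.card_univ, hm, nsmul_eq_mul, mul_one]
          rw [Finset.sum_eq_single (π (i k))]
          · simp
          · intro j _ hj
            simp [hj]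
          · simp
        · intro r _ hr
          simp [hr]
        · simp
      refine Summable.of_nonneg_of_le (fun k => ?_) (fun k => ?_)
        ((summable_geometric_of_lt_one (r := (√2)⁻¹) (by positivity)
          (inv_lt_one_of_one_lt₀ (by rw [Real.lt_sqrt] <;> norm_num))).mul_left (2 * (3 + m : ℝ)))
      · have := hDlow k
        have := hq4 k
        exact div_nonneg (Finset.sum_nonneg fun _ _ => Finset.sum_nonneg fun _ _ => by positivity)
          (by linarith)
      · rw [hR]
        have hsq : |y k (i k)| ≤ √|q k| := Real.le_sqrt_of_sq_le (hsqq k)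
        have hsq1 : 1 ≤ √|q k| := Real.one_le_sqrt.2 (by linarith [hq4 k])
        have hsqk : √2 ^ k ≤ √|q k| := by
          refine Real.le_sqrt_of_sq_le ?_
          rw [← pow_mul, mul_comm, pow_mul, Real.sq_sqrt zero_le_two, hqpow k, abs_mul,
            abs_of_pos (by positivity : (0 : ℝ) < 2 ^ k)]
          exact le_mul_of_one_le_right (by positivity) (by linarith [hq4 0])
        have h1 : |2 * y k (i k) - (q k)⁻¹ * y k (i k)| ≤ 3 * |y k (i k)| := by
          refine (abs_sub _ _).trans ?_
          rw [abs_mul, abs_mul, abs_two, abs_inv]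
          have : |q k|⁻¹ ≤ 1 := inv_le_one_of_one_le₀ (by linarith [hq4 k])
          nlinarith [abs_nonneg (y k (i k))]
        have h2 : |2 * y k (i k) - (q k)⁻¹ * y k (i k)| + m ≤ (3 + m) * √|q k| := by
          have : (m : ℝ) ≤ m * √|q k| := le_mul_of_one_le_right (by positivity) hsq1
          linarith
        have h3 : √|q k| * √|q k| = |q k| := Real.mul_self_sqrt (abs_nonneg _)
        have hDk : 0 < D k := by linarith [hDlow k, hq4 k]
        rw [div_le_iff₀ hDk, inv_pow]
        have h5 : (√|q k|)⁻¹ ≤ (√2 ^ k)⁻¹ := by gcongr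
        calc |2 * y k (i k) - (q k)⁻¹ * y k (i k)| + m ≤ (3 + m) * √|q k| := h2
          _ = 2 * (3 + m) * (√|q k|)⁻¹ * (|q k| / 2) := by
              have h6 : (√|q k|)⁻¹ * |q k| = √|q k| := by
                rw [inv_mul_eq_iff_eq_mul₀ (by positivity), h3]
              linear_combination -(3 + (m : ℝ)) * h6
          _ ≤ 2 * (3 + m) * (√2 ^ k)⁻¹ * D k := by
              gcongr
              exact hDlow k
  intro U hU hb ε hε
  obtain ⟨v, G, B, h1, h2, h3, h4, h5, h6⟩ := hadm U hU hb ε hε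
  refine ⟨v, G, B, h1, h2, h3, ?_, ?_, fun t ht => ?_⟩
  · rwa [← hy0]
  · rwa [← hy0]
  · rw [← hy0]
    have h7 : 2 * (2 * (m : ℝ)) ^ m * D 0 ≤ 4 * (2 * m) ^ m * x ^ m :=
      calc 2 * (2 * (m : ℝ)) ^ m * D 0 ≤ 2 * (2 * (m : ℝ)) ^ m * (2 * x ^ m) := by gcongr
        _ = _ := by ring
    linarith [h6 t ht, mul_le_mul_of_nonneg_right h7 (measureReal_nonneg (μ := volume) (s := U))]

end

section

variable [DecidableEq ι]

lemma monomialMatrix_apply_of_ne (π : Equiv.Perm ι) (y : ι → ℝ) {k l : ι} (h : π k ≠ l) :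
    monomialMatrix π y k l = 0 := if_neg h

lemma vecMulVec_single_eq_monomialMatrix (π : Equiv.Perm ι) (i : ι) (c d : ℝ) :
    Matrix.vecMulVec (Pi.single i c) (Pi.single (π i) d) =
      monomialMatrix π (Pi.single i (c * d)) := by
  ext k l
  rw [Matrix.vecMulVec_apply, monomialMatrix_apply]
  by_cases hk : k = i
  · subst hk
    by_cases hl : π k = l
    · subst hl; simp
    · simp [hl, Ne.symm hl]
  · simp [hk]

variable [Fintype ι]

/-- Monomial matrices are admissible, with a constant depending on a bound for their entries. -/
lemma admissible_monomialMatrix {α : ℝ} (hα : α ∈ Ico (0 : ℝ) 1) {N m : ℕ}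
    (hm : Fintype.card ι = m) (hm2 : 2 ≤ m) {K : Set (Matrix ι ι ℝ)} {π : Equiv.Perm ι}
    (hK : ∀ y, (monomialMatrix π y).det = 1 → monomialMatrix π y ∈ K) {x : ℝ} (hx : 2 ≤ x)
    {y : ι → ℝ} (hy : ∀ i, |y i| ≤ x) :
    Admissible α N m K (4 * (2 * m) ^ m * x ^ m) (monomialMatrix π y) := by
  suffices h : ∀ (s : Finset ι) (y : ι → ℝ), (∀ i, |y i| ≤ x) → (∀ i ∉ s, |y i| = x) →
      Admissible α N m K (4 * (2 * m) ^ m * x ^ m) (monomialMatrix π y) from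
    h Finset.univ y hy fun i hi => absurd (Finset.mem_univ i) hi
  intro s
  induction s using Finset.induction_on with
  | empty =>
    intro y _ hy
    exact admissible_monomialMatrix_of_abs_eq hα hm hm2 hK hx fun i => hy i (Finset.notMem_empty i)
  | insert i s _ ih =>
    intro y hy hy'
    have hmem : ∀ r, |r| = x → ∀ j, |Function.update y i r j| ≤ x := fun r hr j => by
      by_cases hj : j = i
      · subst hj; rw [Function.update_self, hr]
      · rw [Function.update_of_ne hj]; exact hy j
    have hmem' : ∀ r, |r| = x → ∀ j ∉ s, |Function.update y i r j| = x := fun r hr j hjs => by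
      by_cases hj : j = i
      · subst hj; rw [Function.update_self, hr]
      · rw [Function.update_of_ne hj]
        exact hy' j (by simp [hj, hjs])
    rcases (hy i).eq_or_lt with h | h
    · have := ih _ (hmem (y i) h) (hmem' (y i) h)
      rwa [Function.update_eq_self] at this
    have hxabs : |x| = x := abs_of_pos (by linarith)
    have hxabs' : |-x| = x := by rw [abs_neg, hxabs]
    obtain ⟨hl1, hl2⟩ := abs_lt.1 h
    have hl : (y i + x) / (2 * x) ∈ Ioo (0 : ℝ) 1 :=
      ⟨div_pos (by linarith) (by linarith), (div_lt_one (by linarith)).2 (by linarith)⟩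
    have := Admissible.combine hα (by positivity) (ih _ (hmem x hxabs) (hmem' x hxabs))
      (ih _ (hmem (-x) hxabs') (hmem' (-x) hxabs')) (monomialMatrix_update_sub π y i x (-x)) hl
    rw [monomialMatrix_update_combine] at this
    have h3 : (y i + x) / (2 * x) * x + (1 - (y i + x) / (2 * x)) * -x = y i := by
      have : x ≠ 0 := by linarith
      field_simp
      ring
    rwa [h3, Function.update_eq_self] at this

lemma convex_setOf_admissible_vecMulVec_right {α : ℝ} (hα : α ∈ Ico (0 : ℝ) 1) {N m : ℕ}
    {K : Set (Matrix ι ι ℝ)} {C : ℝ} (hC : 0 ≤ C) (a : ι → ℝ) :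
    Convex ℝ {b : ι → ℝ | Admissible α N m K C (Matrix.vecMulVec a b)} := by
  rw [convex_iff_forall_pos]
  intro b₁ h₁ b₂ h₂ s t hs ht hst
  have h : t = 1 - s := by linarith
  subst h
  have := Admissible.combine hα hC h₁ h₂ (Matrix.vecMulVec_sub a b₁ b₂).symm
    ⟨hs, by linarith⟩
  rw [mem_ofPred_eq, Matrix.vecMulVec_add, Matrix.vecMulVec_smul, Matrix.vecMulVec_smul]
  exact this

lemma convex_setOf_admissible_vecMulVec_left {α : ℝ} (hα : α ∈ Ico (0 : ℝ) 1) {N m : ℕ}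
    {K : Set (Matrix ι ι ℝ)} {C : ℝ} (hC : 0 ≤ C) (b : ι → ℝ) :
    Convex ℝ {a : ι → ℝ | Admissible α N m K C (Matrix.vecMulVec a b)} := by
  rw [convex_iff_forall_pos]
  intro a₁ h₁ a₂ h₂ s t hs ht hst
  have h : t = 1 - s := by linarith
  subst h
  have := Admissible.combine hα hC h₁ h₂ (Matrix.sub_vecMulVec a₁ a₂ b).symm
    ⟨hs, by linarith⟩
  rw [mem_ofPred_eq, Matrix.add_vecMulVec, Matrix.smul_vecMulVec, Matrix.smul_vecMulVec]
  exact this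

lemma sum_smul_single_eq {m : ℕ} (hm0 : m ≠ 0) (a : ι → ℝ) :
    ∑ i, (m : ℝ)⁻¹ • (Pi.single i (m * a i) : ι → ℝ) = a := by
  have : (m : ℝ) ≠ 0 := by exact_mod_cast hm0
  ext j
  simp [Finset.sum_apply, Pi.single_apply, this]

/-- Rank-one matrices are averages of single-entry matrices, hence admissible. -/
lemma admissible_vecMulVec {α : ℝ} (hα : α ∈ Ico (0 : ℝ) 1) {N m : ℕ}
    (hm : Fintype.card ι = m) (hm2 : 2 ≤ m) {K : Set (Matrix ι ι ℝ)}
    (hK : ∀ i j, ∃ π : Equiv.Perm ι, π i = j ∧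
      ∀ y, (monomialMatrix π y).det = 1 → monomialMatrix π y ∈ K) {x : ℝ} (hx : 2 ≤ x)
    {a b : ι → ℝ} (hab : ∀ i j, m ^ 2 * |a i * b j| ≤ x) :
    Admissible α N m K (4 * (2 * m) ^ m * x ^ m) (Matrix.vecMulVec a b) := by
  have hC : 0 ≤ 4 * (2 * (m : ℝ)) ^ m * x ^ m := by positivity
  have hm0 : (m : ℝ) ≠ 0 := by exact_mod_cast (by omega : m ≠ 0)
  have hsum : ∑ _i : ι, (m : ℝ)⁻¹ = 1 := by
    rw [Finset.sum_const, Finset.card_univ, hm, nsmul_eq_mul, mul_inv_cancel₀ hm0]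
  have key : ∀ i j, Admissible α N m K (4 * (2 * m) ^ m * x ^ m)
      (Matrix.vecMulVec (Pi.single i (m * a i)) (Pi.single j (m * b j))) := fun i j => by
    obtain ⟨π, rfl, hπ⟩ := hK i j
    rw [vecMulVec_single_eq_monomialMatrix]
    refine admissible_monomialMatrix hα hm hm2 hπ hx fun k => ?_
    by_cases hk : k = i
    · subst hk
      rw [Pi.single_eq_same]
      calc |m * a k * (m * b (π k))| = m ^ 2 * |a k * b (π k)| := by
            rw [show (m : ℝ) * a k * (m * b (π k)) = m ^ 2 * (a k * b (π k)) by ring, abs_mul,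
              abs_of_nonneg (by positivity : (0 : ℝ) ≤ m ^ 2)]
        _ ≤ x := hab _ _
    · rw [Pi.single_eq_of_ne hk, abs_zero]; linarith
  have hl : ∀ j, Admissible α N m K (4 * (2 * m) ^ m * x ^ m)
      (Matrix.vecMulVec a (Pi.single j (m * b j))) := fun j => by
    have := (convex_setOf_admissible_vecMulVec_left (N := N) (m := m) (K := K) hα hC
      (Pi.single j (m * b j))).sum_mem (t := Finset.univ) (fun _ _ => by positivity) hsum
      fun i _ => key i j
    rwa [sum_smul_single_eq (by omega)] at this
  have := (convex_setOf_admissible_vecMulVec_right (N := N) (m := m) (K := K) hα hC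
    a).sum_mem (t := Finset.univ) (fun _ _ => by positivity) hsum fun j _ => hl j
  rwa [sum_smul_single_eq (by omega)] at this

end

lemma monomialMatrix_mem_LSet {n : ℕ} (i j : Fin n ⊕ Fin n) :
    ∃ π : Equiv.Perm (Fin n ⊕ Fin n), π i = j ∧ ∀ y, monomialMatrix π y ∈ LSet n := by
  rcases i with i | i <;> rcases j with j | j
  · exact ⟨Equiv.sumCongr (Equiv.swap i j) 1, by simp, fun y =>
      Or.inl ⟨fun _ _ => monomialMatrix_apply_of_ne _ _ Sum.inl_ne_inr,
        fun _ _ => monomialMatrix_apply_of_ne _ _ Sum.inr_ne_inl⟩⟩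
  · exact ⟨(Equiv.sumCongr (Equiv.swap i j) 1).trans (Equiv.sumComm _ _), by simp, fun y =>
      Or.inr ⟨fun _ _ => monomialMatrix_apply_of_ne _ _ Sum.inr_ne_inl,
        fun _ _ => monomialMatrix_apply_of_ne _ _ Sum.inl_ne_inr⟩⟩
  · exact ⟨(Equiv.sumCongr 1 (Equiv.swap i j)).trans (Equiv.sumComm _ _), by simp, fun y =>
      Or.inr ⟨fun _ _ => monomialMatrix_apply_of_ne _ _ Sum.inr_ne_inl,
        fun _ _ => monomialMatrix_apply_of_ne _ _ Sum.inl_ne_inr⟩⟩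
  · exact ⟨Equiv.sumCongr 1 (Equiv.swap i j), by simp, fun y =>
      Or.inl ⟨fun _ _ => monomialMatrix_apply_of_ne _ _ Sum.inl_ne_inr,
        fun _ _ => monomialMatrix_apply_of_ne _ _ Sum.inr_ne_inl⟩⟩

lemma exists_eq_vecMulVec_of_rank_eq_one [Fintype ι] [DecidableEq ι] {A : Matrix ι ι ℝ}
    (hA : A.rank = 1) : ∃ a b : ι → ℝ, A = Matrix.vecMulVec a b := by
  obtain ⟨⟨a, _⟩, -, ha⟩ := finrank_eq_one_iff'.1 hA
  have h : ∀ j, ∃ c : ℝ, c • a = A.mulVec (Pi.single j 1) := fun j => by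
    obtain ⟨c, hc⟩ := ha ⟨A.mulVec (Pi.single j 1), LinearMap.mem_range_self A.mulVecLin _⟩
    exact ⟨c, congrArg Subtype.val hc⟩
  choose b hb using h
  refine ⟨a, b, ?_⟩
  ext k l
  have := congrFun (hb l) k
  rw [Matrix.mulVec_single_one] at this
  rw [Matrix.vecMulVec_apply, mul_comm]
  exact this.symm

/-- Rank-one matrices can be perturbed into split matrices of determinant one. -/
lemma admissible_of_rank_eq_one {n : ℕ} (hn : 0 < n) {α : ℝ} (hα : α ∈ Ico (0 : ℝ) 1) (N : ℕ)
    {A : Matrix (Fin n ⊕ Fin n) (Fin n ⊕ Fin n) ℝ} (hA : A.rank = 1) :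
    Admissible α N (2 * n) (LSet n ∩ SigmaSet n)
      (4 * (4 * n) ^ (2 * n) * (2 + (2 * n) ^ 2 * frobNorm A) ^ (2 * n)) A := by
  obtain ⟨a, b, rfl⟩ := exists_eq_vecMulVec_of_rank_eq_one hA
  have h := admissible_vecMulVec (α := α) hα (N := N) (ι := Fin n ⊕ Fin n) (m := 2 * n)
    (by simp [two_mul]) (by omega) (K := LSet n ∩ SigmaSet n)
    (x := 2 + (2 * n) ^ 2 * frobNorm (Matrix.vecMulVec a b)) (fun i j => ?_)
    (by
      have := frobNorm_nonneg (Matrix.vecMulVec a b)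
      nlinarith [sq_nonneg (2 * n : ℝ), mul_nonneg (sq_nonneg (2 * n : ℝ)) this])
    (a := a) (b := b) (fun i j => ?_)
  · convert h using 4
    push_cast
    ring
  · obtain ⟨π, hπ, h⟩ := monomialMatrix_mem_LSet i j
    exact ⟨π, hπ, fun y hy => ⟨h y, hy⟩⟩
  · have := abs_le_frobNorm (Matrix.vecMulVec a b) i j
    rw [Matrix.vecMulVec_apply] at this
    push_cast
    have := mul_le_mul_of_nonneg_left this (sq_nonneg (2 * n : ℝ))
    linarith

section

variable [Fintype ι]

lemma lmap_zero_apply (A : Matrix κ ι ℝ) (x : ι → ℝ) (k : κ) :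
    lmap A 0 x k = ∑ i, A k i * x i := by
  simp [lmap]

/-- The linear map `x ↦ A x` followed by the `k`-th coordinate, as a continuous linear form. -/
def lmapForm (A : Matrix κ ι ℝ) (k : κ) : (ι → ℝ) →L[ℝ] ℝ :=
  ∑ i, A k i • ContinuousLinearMap.proj (R := ℝ) (φ := fun _ : ι => ℝ) i

lemma lmapForm_apply (A : Matrix κ ι ℝ) (k : κ) (x : ι → ℝ) : lmapForm A k x = lmap A 0 x k := by
  simp [lmapForm, lmap_zero_apply]

lemma lmapForm_single [DecidableEq ι] (A : Matrix κ ι ℝ) (k : κ) (i : ι) :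
    lmapForm A k (Pi.single i 1) = A k i := by
  rw [lmapForm_apply, lmap_zero_apply]
  simp [Pi.single_apply]

lemma continuous_lmap (A : Matrix κ ι ℝ) : Continuous (lmap A 0) :=
  continuous_pi fun k => by
    simpa only [← lmapForm_apply] using (lmapForm A k).continuous

lemma exists_dist_lmap_le [Fintype κ] (A : Matrix κ ι ℝ) :
    ∃ L : ℝ, 0 ≤ L ∧ ∀ x y, dist (lmap A 0 x) (lmap A 0 y) ≤ L * dist x y := by
  let T : (ι → ℝ) →L[ℝ] (κ → ℝ) := ContinuousLinearMap.pi fun k => lmapForm A k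
  have hT : ∀ x, T x = lmap A 0 x := fun x => funext fun k => lmapForm_apply A k x
  refine ⟨‖T‖, norm_nonneg _, fun x y => ?_⟩
  rw [← hT, ← hT, dist_eq_norm, dist_eq_norm, ← map_sub]
  exact T.le_opNorm _

end

section

variable [Fintype ι] [DecidableEq ι]

lemma IsPerturbation.hasWeakGradientOn {α ε : ℝ} {U : Set (ι → ℝ)} {v : (ι → ℝ) → ι → ℝ}
    {G : (ι → ℝ) → Matrix ι ι ℝ} (h : IsPerturbation α ε U v G)
    (hb : Bornology.IsBounded U) (A : Matrix ι ι ℝ) :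
    HasWeakGradientOn (fun x => lmap A 0 x + v x) (fun x => A + G x) U where
  integrable := ((continuous_lmap A).add h.continuous).continuousOn.integrableOn_compact
    hb.isCompact_closure |>.mono_set subset_closure
  integrable_grad k i := by
    have hfin : volume U ≠ ⊤ := hb.measure_lt_top.ne
    exact (integrableOn_const hfin).add (h.integrable k i).integrableOn
  parts φ hφ hc hs k i := by
    have hφ1 : ContDiff ℝ 1 φ := by exact_mod_cast hφ 1
    have h0 : ∀ x ∉ U, φ x = 0 := fun x hx => image_eq_zero_of_notMem_tsupport fun hx' => hx (hs hx')
    have h0' : ∀ x ∉ U, fderiv ℝ φ x = 0 := fun x hx =>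
      image_eq_zero_of_notMem_tsupport fun hx' => hx (hs (tsupport_fderiv_subset ℝ hx'))
    rw [setIntegral_eq_integral_of_forall_compl_eq_zero fun x hx => by simp [h0' x hx],
      setIntegral_eq_integral_of_forall_compl_eq_zero fun x hx => by simp [h0 x hx]]
    have hl : ∫ x, lmapForm A k x * fderiv ℝ φ x (Pi.single i 1) = -∫ x, A k i * φ x := by
      rw [integral_mul_fderiv_eq_neg_fderiv_mul_of_integrable]
      · simp only [ContinuousLinearMap.fderiv, lmapForm_single]
      · simp only [ContinuousLinearMap.fderiv]
        exact (hφ1.continuous.integrable_of_hasCompactSupport hc).const_mul _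
      · exact integrable_mul_fderiv (lmapForm A k).continuous hφ1 hc _
      · exact ((lmapForm A k).continuous.mul hφ1.continuous).integrable_of_hasCompactSupport
          hc.mul_left
      · exact fun x _ => (lmapForm A k).differentiableAt
      · exact fun x _ => hφ1.differentiable one_ne_zero x
    have hv := h.parts φ hφ1 hc k i
    simp only [Pi.add_apply, Matrix.add_apply, add_mul]
    rw [integral_add, integral_add, hv, neg_add, ← hl]
    · simp only [lmapForm_apply]
    · exact (hφ1.continuous.integrable_of_hasCompactSupport hc).const_mul _
    · exact integrable_mul_of_hasCompactSupport (h.integrable k i) hφ1.continuous hc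
    · simp only [← lmapForm_apply]
      exact integrable_mul_fderiv (lmapForm A k).continuous hφ1 hc _
    · exact integrable_mul_fderiv ((continuous_apply k).comp h.continuous) hφ1 hc _

lemma IsPerturbation.memHolder {α ε : ℝ} (hα : α ∈ Ico (0 : ℝ) 1) {U : Set (ι → ℝ)}
    {v : (ι → ℝ) → ι → ℝ} {G : (ι → ℝ) → Matrix ι ι ℝ} (h : IsPerturbation α ε U v G)
    {S : Set (ι → ℝ)} (hb : Bornology.IsBounded S) (A : Matrix ι ι ℝ) :
    MemHolder α S (fun x => lmap A 0 x + v x) := by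
  refine ⟨((continuous_lmap A).add h.continuous).continuousOn, ?_⟩
  obtain ⟨L, hL, hA⟩ := exists_dist_lmap_le A
  obtain ⟨R, hR⟩ := Metric.isBounded_iff.1 hb
  refine ⟨L * (max R 1) ^ (1 - α) + ε, fun x hx y hy => ?_⟩
  have h1 : dist x y ≤ max R 1 ^ (1 - α) * dist x y ^ α := by
    rcases (dist_nonneg (x := x) (y := y)).eq_or_lt with h0 | h0
    · rw [← h0]
      positivity
    · calc dist x y = dist x y ^ (1 - α) * dist x y ^ α := by
            rw [← Real.rpow_add h0, sub_add_cancel, Real.rpow_one]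
        _ ≤ _ := by
            gcongr
            · linarith [hα.2]
            · exact (hR hx hy).trans (le_max_left _ _)
  calc dist (lmap A 0 x + v x) (lmap A 0 y + v y)
      ≤ dist (lmap A 0 x) (lmap A 0 y) + dist (v x) (v y) := dist_add_add_le _ _ _ _
    _ ≤ L * (max R 1 ^ (1 - α) * dist x y ^ α) + ε * dist x y ^ α := by
        gcongr
        · exact (hA x y).trans (by gcongr)
        · exact h.holder x y
    _ = _ := by ring

lemma IsPerturbation.holderNorm_le {α ε : ℝ} (hε : 0 ≤ ε) {U : Set (ι → ℝ)}
    {v : (ι → ℝ) → ι → ℝ} {G : (ι → ℝ) → Matrix ι ι ℝ} (h : IsPerturbation α ε U v G)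
    (S : Set (ι → ℝ)) : holderNorm α S v ≤ 2 * ε := by
  rw [two_mul]
  refine add_le_add (Real.sSup_le ?_ hε) (Real.sSup_le ?_ hε)
  · rintro _ ⟨x, -, rfl⟩
    exact h.norm_le x
  · rintro _ ⟨x, -, y, -, hxy, rfl⟩
    exact (div_le_iff₀ (Real.rpow_pos_of_pos (dist_pos.2 hxy) _)).2 (h.holder x y)

end

lemma holderNorm_nonneg [Fintype ι] [Fintype κ] (α : ℝ) (S : Set (ι → ℝ))
    (u : (ι → ℝ) → κ → ℝ) : 0 ≤ holderNorm α S u := by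
  refine add_nonneg (Real.sSup_nonneg ?_) (Real.sSup_nonneg ?_)
  · rintro _ ⟨x, -, rfl⟩
    exact norm_nonneg _
  · rintro _ ⟨x, -, y, -, -, rfl⟩
    positivity

/-- A weak `L^m` bound on a finite measure space gives an `L^p` bound for `1 ≤ p < m`. -/
lemma exists_lintegral_rpow_le {X : Type*} [MeasurableSpace X] (μ : Measure X) [IsFiniteMeasure μ]
    (K : ℝ) {p m : ℝ} (hp : 1 ≤ p) (hpm : p < m) :
    ∃ C : ℝ, 0 ≤ C ∧ ∀ f : X → ℝ, 0 ≤ f → AEMeasurable f μ →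
      (∀ t, 0 < t → μ {x | t < f x} ≤ ENNReal.ofReal (K * t ^ (-m))) →
      ∫⁻ x, ENNReal.ofReal (f x ^ p) ∂μ ≤ ENNReal.ofReal C := by
  set J : ENNReal := ∫⁻ t in Ioi (1 : ℝ), ENNReal.ofReal (K * t ^ (p - 1 - m)) with hJ
  have hJfin : J ≠ ⊤ :=
    ((integrableOn_Ioi_rpow_of_lt (by linarith) one_pos).const_mul K).lintegral_lt_top.ne
  set T : ENNReal := ENNReal.ofReal p * (μ univ + J) with hT
  have hTfin : T ≠ ⊤ :=
    ENNReal.mul_ne_top ENNReal.ofReal_ne_top (ENNReal.add_ne_top.2 ⟨measure_ne_top _ _, hJfin⟩)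
  refine ⟨T.toReal, ENNReal.toReal_nonneg, fun f hf hfm hft => ?_⟩
  rw [ENNReal.ofReal_toReal hTfin,
    lintegral_rpow_eq_lintegral_meas_lt_mul μ (Eventually.of_forall hf) hfm (by linarith)]
  refine mul_le_mul_right ?_ _
  rw [← Ioc_union_Ioi_eq_Ioi zero_le_one]
  refine (lintegral_union_le _ _ _).trans (add_le_add ?_ ?_)
  · calc ∫⁻ t in Ioc (0 : ℝ) 1, μ {x | t < f x} * ENNReal.ofReal (t ^ (p - 1))
        ≤ ∫⁻ _ in Ioc (0 : ℝ) 1, μ univ := by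
          refine setLIntegral_mono' measurableSet_Ioc fun t ht => ?_
          calc μ {x | t < f x} * ENNReal.ofReal (t ^ (p - 1)) ≤ μ univ * 1 := by
                gcongr
                · exact subset_univ _
                · rw [← ENNReal.ofReal_one]
                  exact ENNReal.ofReal_le_ofReal
                    (Real.rpow_le_one ht.1.le ht.2 (by linarith))
            _ = _ := mul_one _
      _ = μ univ := by simp
  · refine setLIntegral_mono' measurableSet_Ioi fun t ht => ?_
    have ht0 : 0 < t := one_pos.trans ht
    calc μ {x | t < f x} * ENNReal.ofReal (t ^ (p - 1))
        ≤ ENNReal.ofReal (K * t ^ (-m)) * ENNReal.ofReal (t ^ (p - 1)) := by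
          gcongr
          exact hft t ht0
      _ = ENNReal.ofReal (K * t ^ (p - 1 - m)) := by
          rw [← ENNReal.ofReal_mul' (by positivity), mul_assoc, ← Real.rpow_add ht0]
          congr 3
          ring

/-- Distance to the matrices vanishing at prescribed entries. -/
lemma frobDist_setOf_eq_zero [Fintype ι] [Fintype κ] (P : κ → ι → Prop) [∀ k i, Decidable (P k i)]
    (X : Matrix κ ι ℝ) :
    frobDist X {Y | ∀ k i, P k i → Y k i = 0} =
      frobNorm (Matrix.of fun k i => if P k i then X k i else 0) := by
  refine IsLeast.csInf_eq ⟨⟨Matrix.of fun k i => if P k i then 0 else X k i, ?_, ?_⟩, ?_⟩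
  · intro k i hk
    simp [hk]
  · refine congrArg frobNorm ?_
    ext k i
    by_cases hk : P k i <;> simp [hk]
  · rintro _ ⟨Y, hY, rfl⟩
    refine Real.sqrt_le_sqrt (Finset.sum_le_sum fun k _ => Finset.sum_le_sum fun i _ => ?_)
    by_cases hk : P k i
    · simp [hk, hY k i hk]
    · simp [hk, sq_nonneg]

/-- Bounded sequences in `L^p` which tend to zero against test functions tend to zero weakly. -/
lemma tendsto_integral_mul_zero [Fintype ι] {p q : ENNReal} [p.HolderTriple q 1] (hq : q ≠ ⊤)
    (hq1 : 1 ≤ q) {f : ℕ → (ι → ℝ) → ℝ} (hf : ∀ j, AEStronglyMeasurable (f j) volume)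
    {C : ENNReal} (hC : C ≠ ⊤) (hfC : ∀ j, eLpNorm (f j) p volume ≤ C)
    (hφ : ∀ φ : (ι → ℝ) → ℝ, ContDiff ℝ 1 φ → HasCompactSupport φ →
      Tendsto (fun j => ∫ x, f j x * φ x) atTop (𝓝 0))
    {g : (ι → ℝ) → ℝ} (hg : MemLp g q volume) :
    Tendsto (fun j => ∫ x, f j x * g x) atTop (𝓝 0) := by
  have hfp : ∀ j, MemLp (f j) p volume := fun j => ⟨hf j, (hfC j).trans_lt hC.lt_top⟩
  rw [Metric.tendsto_atTop]
  intro ε hε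
  have hδ : 0 < ε / 2 / (C.toReal + 1) := by positivity
  obtain ⟨φ, hφc, hφs, hφg⟩ := hg.exist_eLpNorm_sub_le hq hq1 hδ
  have hφ1 : ContDiff ℝ 1 φ := hφs.of_le (by exact_mod_cast le_top)
  have hφq : MemLp φ q volume := hφ1.continuous.memLp_of_hasCompactSupport hφc
  obtain ⟨J, hJ⟩ := Metric.tendsto_atTop.1 (hφ φ hφ1 hφc) (ε / 2) (half_pos hε)
  refine ⟨J, fun j hj => ?_⟩
  have h1 := hJ j hj
  rw [dist_zero_right] at h1 ⊢
  have hsplit : ∫ x, f j x * g x = (∫ x, f j x * (g - φ) x) + ∫ x, f j x * φ x := by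
    rw [← integral_add]
    · refine integral_congr_ae (Eventually.of_forall fun x => ?_)
      simp only [Pi.sub_apply]
      ring
    · exact (hfp j).integrable_mul (hg.sub hφq)
    · exact (hfp j).integrable_mul hφq
  have h2 : ‖∫ x, f j x * (g - φ) x‖ ≤ ε / 2 := by
    refine (norm_integral_le_lintegral_norm _).trans (ENNReal.toReal_le_of_le_ofReal (by positivity) ?_)
    calc ∫⁻ x, ENNReal.ofReal ‖f j x * (g - φ) x‖ = eLpNorm (f j • (g - φ)) 1 volume := by
          rw [eLpNorm_one_eq_lintegral_enorm]
          simp only [ofReal_norm, Pi.smul_apply', smul_eq_mul]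
      _ ≤ eLpNorm (f j) p volume * eLpNorm (g - φ) q volume :=
          eLpNorm_smul_le_mul_eLpNorm (hg.sub hφq).1 (hf j)
      _ ≤ C * ENNReal.ofReal (ε / 2 / (C.toReal + 1)) := by gcongr; exact hfC j
      _ = ENNReal.ofReal (C.toReal * (ε / 2 / (C.toReal + 1))) := by
          rw [ENNReal.ofReal_mul ENNReal.toReal_nonneg, ENNReal.ofReal_toReal hC]
      _ ≤ ENNReal.ofReal (ε / 2) := by
          refine ENNReal.ofReal_le_ofReal ?_
          rw [mul_div_left_comm]
          refine mul_le_of_le_one_right (by positivity) ((div_le_one (by positivity)).2 (by linarith))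
  rw [hsplit]
  linarith [norm_add_le (∫ x, f j x * (g - φ) x) (∫ x, f j x * φ x)]

lemma frobNorm_of_ite_le [Fintype ι] (P : ι → ι → Prop)
    [∀ k i, Decidable (P k i)] (X : Matrix ι ι ℝ) :
    frobNorm (Matrix.of fun k i => if P k i then X k i else 0 : Matrix ι ι ℝ) ≤ frobNorm X := by
  refine Real.sqrt_le_sqrt (Finset.sum_le_sum fun k _ => Finset.sum_le_sum fun i _ => ?_)
  by_cases hk : P k i <;> simp [hk, sq_nonneg]

lemma aemeasurable_frobNorm [Fintype ι] {X : Type*} [MeasurableSpace X] {μ : Measure X}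
    {H : X → Matrix ι ι ℝ} (hH : ∀ k i, AEMeasurable (fun x => H x k i) μ) :
    AEMeasurable (fun x => frobNorm (H x)) μ := by
  unfold frobNorm
  refine Real.continuous_sqrt.measurable.comp_aemeasurable ?_
  exact Finset.aemeasurable_fun_sum _ fun k _ => Finset.aemeasurable_fun_sum _ fun i _ =>
    (hH k i).pow_const 2

lemma integrable_frobNorm [Fintype ι] {X : Type*} [MeasurableSpace X] {μ : Measure X}
    {H : X → Matrix ι ι ℝ} (hH : ∀ k i, Integrable (fun x => H x k i) μ) :
    Integrable (fun x => frobNorm (H x)) μ := by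
  have : Integrable (fun x => ∑ k, ∑ i, |H x k i|) μ :=
    integrable_finsetSum _ fun k _ => integrable_finsetSum _ fun i _ => (hH k i).abs
  refine this.mono' (aemeasurable_frobNorm fun k i => (hH k i).aemeasurable).aestronglyMeasurable
    (Eventually.of_forall fun x => ?_)
  exact (abs_of_nonneg (frobNorm_nonneg (H x))).le.trans (frobNorm_le_sum_abs _)

/-- The distance to a coordinate subspace stays away from zero if some mean value does. -/
lemma liminf_integral_frobDist_pos [Fintype ι] {X : Type*} [MeasurableSpace X]
    {μ : Measure X} {H : ℕ → X → Matrix ι ι ℝ} (hH : ∀ j k i, Integrable (fun x => H j x k i) μ)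
    {C : ℝ} (hC : ∀ j, ∫ x, frobNorm (H j x) ∂μ ≤ C) {P : ι → ι → Prop} {k : ι} {i : ι}
    (hk : P k i) {c : ℝ} (hc : c ≠ 0) (hlim : Tendsto (fun j => ∫ x, H j x k i ∂μ) atTop (𝓝 c)) :
    0 < atTop.liminf fun j => ∫ x, frobDist (H j x) {Y | ∀ k i, P k i → Y k i = 0} ∂μ := by
  classical
  simp only [frobDist_setOf_eq_zero P]
  have hinteg : ∀ j, Integrable
      (fun x => frobNorm (Matrix.of fun k i => if P k i then H j x k i else 0 : Matrix ι ι ℝ)) μ :=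
    fun j =>
    integrable_frobNorm fun k i => by
      by_cases h : P k i
      · simpa [h] using hH j k i
      · simp [h]
  have hlow : ∀ j, |∫ x, H j x k i ∂μ| ≤
      ∫ x, frobNorm (Matrix.of fun k i => if P k i then H j x k i else 0 : Matrix ι ι ℝ) ∂μ :=
    fun j => by
    refine abs_integral_le_integral_abs.trans (integral_mono (hH j k i).abs (hinteg j) fun x => ?_)
    have := abs_le_frobNorm (Matrix.of fun k i => if P k i then H j x k i else 0 : Matrix ι ι ℝ) k i
    simpa [hk] using this
  have hup : ∀ j, ∫ x, frobNorm (Matrix.of fun k i => if P k i then H j x k i else 0 : Matrix ι ι ℝ) ∂μ ≤ C :=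
    fun j => (integral_mono (hinteg j) (integrable_frobNorm (hH j)) fun x =>
      frobNorm_of_ite_le P _).trans (hC j)
  calc 0 < |c| := abs_pos.2 hc
    _ = atTop.liminf fun j => |∫ x, H j x k i ∂μ| := hlim.abs.liminf_eq.symm
    _ ≤ _ := liminf_le_liminf (Eventually.of_forall hlow) hlim.abs.isBoundedUnder_ge
        (isBoundedUnder_of ⟨C, hup⟩).isCoboundedUnder_ge

/-- Markov's inequality combined with a tail bound off the exceptional set. -/
lemma measureReal_setOf_lt_mul_pow_le {X : Type*} [MeasurableSpace X] {μ : Measure X}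
    {Ω B : Set X} (hΩ : μ Ω ≠ ⊤) {F : X → ℝ} (hF : 0 ≤ F) (hFm : AEMeasurable F (μ.restrict B))
    {N m : ℕ} (hmN : m ≤ N) {ε R : ℝ} (hε : 0 ≤ ε) (hBm : MeasurableSet B) (hBΩ : B ⊆ Ω)
    (hB : ∫⁻ x in B, ENNReal.ofReal ((1 + F x) ^ N) ∂μ ≤ ENNReal.ofReal ε) {t : ℝ} (ht : 0 < t)
    (hR : μ.real {x ∈ Ω \ B | t < F x} * t ^ m ≤ R) :
    μ.real {x ∈ Ω | t < F x} * t ^ m ≤ R + ε := by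
  have h1 : μ.real {x ∈ B | t < F x} * t ^ m ≤ ε := by
    have h2 := mul_meas_ge_le_lintegral₀ (μ := μ.restrict B)
      (f := fun x => ENNReal.ofReal ((1 + F x) ^ N))
      (((hFm.const_add 1).pow_const N).ennreal_ofReal) (ENNReal.ofReal (t ^ m))
    have h3 : μ {x ∈ B | t < F x} ≤
        μ.restrict B {x | ENNReal.ofReal (t ^ m) ≤ ENNReal.ofReal ((1 + F x) ^ N)} := by
      rw [Measure.restrict_apply' hBm]
      refine measure_mono fun x hx => ⟨ENNReal.ofReal_le_ofReal ?_, hx.1⟩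
      calc t ^ m ≤ (1 + F x) ^ m := pow_le_pow_left₀ ht.le (by linarith [hx.2]) m
        _ ≤ (1 + F x) ^ N := pow_le_pow_right₀ (le_add_of_nonneg_right (hF x)) hmN
    have h4 : ENNReal.ofReal (t ^ m) * μ {x ∈ B | t < F x} ≤ ENNReal.ofReal ε :=
      (mul_le_mul_right h3 _).trans (h2.trans hB)
    have h5 := ENNReal.toReal_le_of_le_ofReal hε h4
    rw [ENNReal.toReal_mul, ENNReal.toReal_ofReal (by positivity), mul_comm] at h5
    exact h5
  have h2 : μ.real {x ∈ Ω | t < F x} ≤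
      μ.real {x ∈ Ω \ B | t < F x} + μ.real {x ∈ B | t < F x} := by
    refine (measureReal_mono (μ := μ) (fun x hx => ?_) ?_).trans (measureReal_union_le _ _)
    · by_cases hxB : x ∈ B
      · exact Or.inr ⟨hxB, hx.2⟩
      · exact Or.inl ⟨⟨hx.1, hxB⟩, hx.2⟩
    · exact measure_ne_top_of_subset (union_subset (fun x hx => hx.1.1) fun x hx => hBΩ hx.1) hΩ
  have h3 := mul_le_mul_of_nonneg_right h2 (by positivity : 0 ≤ t ^ m)
  linarith

/-- Moments over the exceptional set. -/
lemma norm_setIntegral_one_add_rpow_le {X : Type*} [MeasurableSpace X] {μ : Measure X}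
    {E B : Set X} {F : X → ℝ} (hF : 0 ≤ F) {N : ℕ} {s ε : ℝ} (hs : 0 ≤ s) (hsN : s ≤ N)
    (hε : 0 ≤ ε) (hEB : E ⊆ B)
    (hB : ∫⁻ x in B, ENNReal.ofReal ((1 + F x) ^ N) ∂μ ≤ ENNReal.ofReal ε) :
    ‖∫ x in E, (1 + F x ^ s) ∂μ‖ ≤ 2 * ε := by
  refine (norm_integral_le_lintegral_norm _).trans
    (ENNReal.toReal_le_of_le_ofReal (by positivity) ?_)
  calc ∫⁻ x in E, ENNReal.ofReal ‖1 + F x ^ s‖ ∂μ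
      ≤ ∫⁻ x in B, ENNReal.ofReal ‖1 + F x ^ s‖ ∂μ := lintegral_mono_set hEB
    _ ≤ ∫⁻ x in B, ENNReal.ofReal 2 * ENNReal.ofReal ((1 + F x) ^ N) ∂μ := by
        refine lintegral_mono fun x => ?_
        have h0 : 0 ≤ F x := hF x
        rw [← ENNReal.ofReal_mul zero_le_two, Real.norm_eq_abs, abs_of_nonneg (by positivity)]
        refine ENNReal.ofReal_le_ofReal ?_
        have h1 : F x ^ s ≤ (1 + F x) ^ N := by
          rw [← Real.rpow_natCast]
          calc F x ^ s ≤ (1 + F x) ^ s := Real.rpow_le_rpow h0 (by linarith) hs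
            _ ≤ (1 + F x) ^ (N : ℝ) := Real.rpow_le_rpow_of_exponent_le (by linarith) hsN
        linarith [one_le_pow₀ (n := N) (by linarith : 1 ≤ 1 + F x)]
    _ = ENNReal.ofReal 2 * ∫⁻ x in B, ENNReal.ofReal ((1 + F x) ^ N) ∂μ :=
        lintegral_const_mul' _ _ ENNReal.ofReal_ne_top
    _ ≤ ENNReal.ofReal 2 * ENNReal.ofReal ε := by gcongr
    _ = ENNReal.ofReal (2 * ε) := (ENNReal.ofReal_mul zero_le_two).symm

section

variable [Fintype ι] [DecidableEq ι]

lemma IsPerturbation.abs_integral_mul_le {α ε : ℝ} {U : Set (ι → ℝ)} {v : (ι → ℝ) → ι → ℝ}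
    {G : (ι → ℝ) → Matrix ι ι ℝ} (h : IsPerturbation α ε U v G) {φ : (ι → ℝ) → ℝ}
    (hφ : ContDiff ℝ 1 φ) (hc : HasCompactSupport φ) (k i : ι) :
    |∫ x, G x k i * φ x| ≤ ε * ∫ x, |fderiv ℝ φ x (Pi.single i 1)| := by
  have h1 := h.parts φ hφ hc k i
  rw [← abs_neg, ← h1, ← integral_const_mul, ← Real.norm_eq_abs]
  refine norm_integral_le_of_norm_le ?_ (Eventually.of_forall fun x => ?_)
  · exact ((continuous_fderiv_apply hφ _).integrable_of_hasCompactSupport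
      (hasCompactSupport_fderiv_apply hc _)).abs.const_mul ε
  · rw [norm_mul]
    exact mul_le_mul_of_nonneg_right ((norm_le_pi_norm (v x) k).trans (h.norm_le x))
      (norm_nonneg _)

/-- Gradients of small perturbations that are bounded in `L^{3/2}` converge weakly. -/
lemma tendsto_setIntegral_add_mul {α : ℝ} {U : Set (ι → ℝ)} (hU : IsOpen U)
    (hb : Bornology.IsBounded U) {e : ℕ → ℝ} (he : Tendsto e atTop (𝓝 0))
    {v : ℕ → (ι → ℝ) → ι → ℝ} {G : ℕ → (ι → ℝ) → Matrix ι ι ℝ}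
    (h : ∀ j, IsPerturbation α (e j) U (v j) (G j)) (A : Matrix ι ι ℝ) {C : ℝ}
    (hC : ∀ j, ∫⁻ x in U, ENNReal.ofReal (frobNorm (A + G j x) ^ (3 / 2 : ℝ)) ≤ ENNReal.ofReal C)
    {g : (ι → ℝ) → ℝ} (hg : Measurable g) (hgb : ∃ D : ℝ, ∀ x, |g x| ≤ D) (k i : ι) :
    Tendsto (fun j => ∫ x in U, (A + G j x) k i * g x) atTop (𝓝 (∫ x in U, A k i * g x)) := by
  obtain ⟨D, hD⟩ := hgb
  have hUm := hU.measurableSet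
  have hfin : IsFiniteMeasure (volume.restrict U) :=
    isFiniteMeasure_restrict.2 hb.measure_lt_top.ne
  have hconj : (ENNReal.ofReal (3 / 2)).HolderTriple (ENNReal.ofReal 3) 1 := by
    have : (3 / 2 : ℝ).HolderConjugate 3 := by
      rw [Real.holderConjugate_iff]; norm_num
    have := Real.HolderTriple.ennrealOfReal this
    rwa [ENNReal.ofReal_one] at this
  have hp0 : ENNReal.ofReal (3 / 2) ≠ 0 := by norm_num
  have hGU : ∀ j, (fun x => G j x k i) = U.indicator fun x => (A + G j x) k i - A k i := fun j => by
    ext x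
    by_cases hx : x ∈ U
    · simp [hx]
    · simp [hx, (h j).grad_eq_zero x hx]
  have hgi : Integrable g (volume.restrict U) :=
    (MemLp.of_bound (p := 1) hg.aestronglyMeasurable D (Eventually.of_forall hD)).integrable le_rfl
  have hgq : MemLp (U.indicator g) (ENNReal.ofReal 3) volume := by
    rw [memLp_indicator_iff_restrict hUm]
    exact MemLp.of_bound hg.aestronglyMeasurable D (Eventually.of_forall hD)
  have hmeas : ∀ j, AEStronglyMeasurable (fun x => (A + G j x) k i) (volume.restrict U) := fun j =>
    (((h j).integrable k i).aestronglyMeasurable.restrict).const_add _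
  have hbound : ∀ j, eLpNorm (fun x => G j x k i) (ENNReal.ofReal (3 / 2)) volume ≤
      ENNReal.ofReal C ^ (1 / (3 / 2) : ℝ) +
        eLpNorm (fun _ => A k i) (ENNReal.ofReal (3 / 2)) (volume.restrict U) := fun j => by
    rw [hGU, eLpNorm_indicator_eq_eLpNorm_restrict hUm]
    refine (eLpNorm_sub_le (hmeas j) aestronglyMeasurable_const ?_).trans ?_
    · rw [← ENNReal.ofReal_one]; exact ENNReal.ofReal_le_ofReal (by norm_num)
    · gcongr
      refine (eLpNorm_mono_real (g := fun x => frobNorm (A + G j x)) fun x =>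
        abs_le_frobNorm (A + G j x) k i).trans ?_
      rw [eLpNorm_eq_lintegral_rpow_enorm_toReal hp0 ENNReal.ofReal_ne_top,
        ENNReal.toReal_ofReal (by norm_num)]
      gcongr
      refine le_trans (le_of_eq (lintegral_congr fun x => ?_)) (hC j)
      rw [← ofReal_norm, Real.norm_eq_abs, abs_of_nonneg (frobNorm_nonneg _),
        ENNReal.ofReal_rpow_of_nonneg (frobNorm_nonneg _) (by norm_num)]
  have key := tendsto_integral_mul_zero (p := ENNReal.ofReal (3 / 2)) (q := ENNReal.ofReal 3)
    ENNReal.ofReal_ne_top (by rw [← ENNReal.ofReal_one]; exact ENNReal.ofReal_le_ofReal (by norm_num))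
    (f := fun j x => G j x k i) (fun j => ((h j).integrable k i).aestronglyMeasurable)
    (ENNReal.add_ne_top.2 ⟨ENNReal.rpow_ne_top_of_nonneg (by norm_num) ENNReal.ofReal_ne_top,
      (memLp_const (A k i)).2.ne⟩) hbound (fun φ hφ hc => by
        refine squeeze_zero_norm (fun j => (h j).abs_integral_mul_le hφ hc k i) ?_
        simpa using he.mul_const (∫ x, |fderiv ℝ φ x (Pi.single i 1)|)) hgq
  have hsum : ∀ j, ∫ x in U, (A + G j x) k i * g x =
      (∫ x in U, A k i * g x) + ∫ x, G j x k i * U.indicator g x := fun j => by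
    have h1 : ∫ x, G j x k i * U.indicator g x = ∫ x in U, G j x k i * g x := by
      rw [← integral_indicator hUm]
      refine integral_congr_ae (Eventually.of_forall fun x => ?_)
      by_cases hx : x ∈ U <;> simp [hx]
    rw [h1, ← integral_add (hgi.const_mul _)]
    · simp only [Matrix.add_apply, add_mul]
    · exact ((h j).integrable k i).restrict.mul_bdd (c := D) hg.aestronglyMeasurable
        (Eventually.of_forall hD)
  simp only [hsum]
  simpa using key.const_add (∫ x in U, A k i * g x)

end

lemma L1set_eq (n : ℕ) :
    L1set n = {Y | ∀ k l : Fin n ⊕ Fin n, k.isLeft ≠ l.isLeft → Y k l = 0} := by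
  ext Y
  simp [L1set]

lemma L2set_eq (n : ℕ) :
    L2set n = {Y | ∀ k l : Fin n ⊕ Fin n, k.isLeft = l.isLeft → Y k l = 0} := by
  ext Y
  simp [L2set]

lemma weakType_constant_le {n : ℕ} {F : ℝ} (hF : 0 ≤ F) :
    4 * (4 * n : ℝ) ^ (2 * n) * (2 + (2 * n) ^ 2 * F) ^ (2 * n) + 2 ≤
      (4 * (4 * n) ^ (2 * n) * ((2 + (2 * n) ^ 2) ^ (2 * n) * 2 ^ (2 * n - 1)) + 2) *
        (1 + F ^ (2 * n)) := by
  have h1 : (2 + (2 * n : ℝ) ^ 2 * F) ≤ (2 + (2 * n) ^ 2) * (1 + F) := by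
    nlinarith [sq_nonneg (2 * n : ℝ)]
  have h2 : (2 + (2 * n : ℝ) ^ 2 * F) ^ (2 * n) ≤
      (2 + (2 * n) ^ 2) ^ (2 * n) * 2 ^ (2 * n - 1) * (1 + F ^ (2 * n)) :=
    calc _ ≤ ((2 + (2 * n : ℝ) ^ 2) * (1 + F)) ^ (2 * n) := by gcongr
      _ = (2 + (2 * n : ℝ) ^ 2) ^ (2 * n) * (1 + F) ^ (2 * n) := mul_pow _ _ _
      _ ≤ (2 + (2 * n : ℝ) ^ 2) ^ (2 * n) * (2 ^ (2 * n - 1) * (1 ^ (2 * n) + F ^ (2 * n))) := by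
          gcongr
          exact add_pow_le zero_le_one hF _
      _ = _ := by rw [one_pow, mul_assoc]
  have h3 := mul_le_mul_of_nonneg_left h2 (by positivity : (0 : ℝ) ≤ 4 * (4 * n : ℝ) ^ (2 * n))
  have h4 : 0 ≤ F ^ (2 * n) := by positivity
  linarith

/-- Theorem: optimality of the exponent `2n` for approximate solutions. -/
theorem approximate_rigidity_breakdown (n : ℕ) (hn : 0 < n) :
    ∃ M : ℝ, 1 ≤ M ∧
      ∀ A : Matrix (Fin n ⊕ Fin n) (Fin n ⊕ Fin n) ℝ, A ∉ LSet n → A.rank = 1 →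
      ∀ Ω : Set ((Fin n ⊕ Fin n) → ℝ), IsRegularDomain Ω →
      ∀ α : ℝ, α ∈ Set.Ico (0:ℝ) 1 →
      ∃ (u : ℕ → ((Fin n ⊕ Fin n) → ℝ) → (Fin n ⊕ Fin n) → ℝ)
        (G : ℕ → ((Fin n ⊕ Fin n) → ℝ) → Matrix (Fin n ⊕ Fin n) (Fin n ⊕ Fin n) ℝ),
        (∀ j, HasWeakGradientOn (u j) (G j) Ω ∧ MemHolder α (closure Ω) (u j) ∧
          ∀ x ∈ frontier Ω, u j x = lmap A 0 x) ∧
        -- (i) uniform weak L^{2n} bound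
        (∀ j, ∀ t : ℝ, 0 < t →
          volume {x ∈ Ω | t < frobNorm (G j x)}
            ≤ ENNReal.ofReal (M * (1 + frobNorm A ^ (2 * n)) * t ^ (-(2 * n : ℝ))) * volume Ω) ∧
        -- (ii) the error integral tends to zero for every s ∈ [1,∞)
        (∀ s : ℝ, 1 ≤ s →
          Tendsto (fun j => ∫ x in {x ∈ Ω | G j x ∉ LSet n ∩ SigmaSet n},
              (1 + frobNorm (G j x) ^ s)) atTop (nhds 0)) ∧
        -- (iii) u⁽ʲ⁾ → l_A in C^α(closure Ω)
        Tendsto (fun j => holderNorm α (closure Ω) (fun x => u j x - lmap A 0 x)) atTop (nhds 0) ∧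
        -- (iv) u⁽ʲ⁾ ⇀ l_A in W^{1,p}(Ω) for all p ∈ [1,2n):
        -- bounded in W^{1,p} and gradients converge weakly to A
        (∀ p : ℝ, 1 ≤ p → p < 2 * n →
          ∃ C : ℝ, ∀ j, (∫ x in Ω, frobNorm (G j x) ^ p) ≤ C) ∧
        (∀ g : ((Fin n ⊕ Fin n) → ℝ) → ℝ, Measurable g → (∃ C : ℝ, ∀ x, |g x| ≤ C) →
          ∀ k i, Tendsto (fun j => ∫ x in Ω, G j x k i * g x) atTop
            (nhds (∫ x in Ω, A k i * g x))) ∧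
        -- (v) the distance to both L₁ and L₂ stays bounded away from zero
        (0 < atTop.liminf fun j => ∫ x in Ω, frobDist (G j x) (L1set n)) ∧
        (0 < atTop.liminf fun j => ∫ x in Ω, frobDist (G j x) (L2set n)) := by
  set M : ℝ := 4 * (4 * n) ^ (2 * n) * ((2 + (2 * n) ^ 2) ^ (2 * n) * 2 ^ (2 * n - 1)) + 2 with hM
  refine ⟨M, by have : (0 : ℝ) ≤ 4 * (4 * n) ^ (2 * n) *
    ((2 + (2 * n) ^ 2) ^ (2 * n) * 2 ^ (2 * n - 1)) := by positivity
                linarith, fun A hAL hA Ω hΩ α hα => ?_⟩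
  obtain ⟨hΩo, hΩb, hΩc, -⟩ := hΩ
  have hΩm := hΩo.measurableSet
  have hΩfin : volume Ω ≠ ⊤ := hΩb.measure_lt_top.ne
  have hfin : IsFiniteMeasure (volume.restrict Ω) := isFiniteMeasure_restrict.2 hΩfin
  have hV : 0 < volume.real Ω :=
    ENNReal.toReal_pos (hΩo.measure_pos volume hΩc.nonempty).ne' hΩfin
  set e : ℕ → ℝ := fun j => min (1 / ((j : ℝ) + 1)) (volume.real Ω) with he
  have he0 : ∀ j, 0 < e j := fun j => lt_min Nat.one_div_pos_of_nat hV
  have helim : Tendsto e atTop (𝓝 0) :=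
    squeeze_zero (fun j => (he0 j).le) (fun j => min_le_left _ _)
      tendsto_one_div_add_atTop_nhds_zero_nat
  choose v G B hpert hBm hBΩ hmem hB htail using fun j : ℕ =>
    admissible_of_rank_eq_one hn hα (max j (2 * n)) hA Ω hΩo hΩb (e j) (he0 j)
  have hHint : ∀ j k i, Integrable (fun x => (A + G j x) k i) (volume.restrict Ω) := fun j k i =>
    (((hpert j).hasWeakGradientOn hΩb A).integrable_grad k i)
  have hFint : ∀ j, Integrable (fun x => frobNorm (A + G j x)) (volume.restrict Ω) := fun j =>
    integrable_frobNorm (hHint j)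
  have hweak : ∀ j (t : ℝ), 0 < t → volume {x ∈ Ω | t < frobNorm (A + G j x)} ≤
      ENNReal.ofReal (M * (1 + frobNorm A ^ (2 * n)) * t ^ (-(2 * n : ℝ))) * volume Ω := by
    intro j t ht
    have h1 := measureReal_setOf_lt_mul_pow_le (μ := volume) hΩfin
      (F := fun x => frobNorm (A + G j x)) (fun x => frobNorm_nonneg _)
      ((hFint j).aemeasurable.mono_measure (Measure.restrict_mono_set volume (hBΩ j)))
      (le_max_right j (2 * n)) (he0 j).le (hBm j) (hBΩ j) (hB j) ht (htail j t ht)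
    have h2 : e j ≤ volume.real Ω := min_le_right _ _
    have h3 := mul_le_mul_of_nonneg_right (weakType_constant_le (n := n) (frobNorm_nonneg A)) hV.le
    rw [← hM] at h3
    have h4 : t ^ (-(2 * n : ℝ)) = (t ^ (2 * n))⁻¹ := by
      rw [Real.rpow_neg ht.le]
      exact_mod_cast congrArg Inv.inv (Real.rpow_natCast t (2 * n))
    have h5 : volume.real {x ∈ Ω | t < frobNorm (A + G j x)} ≤
        M * (1 + frobNorm A ^ (2 * n)) * t ^ (-(2 * n : ℝ)) * volume.real Ω := by
      rw [h4, mul_right_comm, ← div_eq_mul_inv, le_div_iff₀ (by positivity)]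
      linarith
    have h6 : volume {x ∈ Ω | t < frobNorm (A + G j x)} ≠ ⊤ :=
      measure_ne_top_of_subset (fun x hx => hx.1) hΩfin
    rw [← ENNReal.ofReal_toReal h6, ← ENNReal.ofReal_toReal hΩfin,
      ← ENNReal.ofReal_mul' ENNReal.toReal_nonneg]
    exact ENNReal.ofReal_le_ofReal h5
  have hLp : ∀ p : ℝ, 1 ≤ p → p < 2 * n → ∃ C : ℝ, 0 ≤ C ∧ ∀ j,
      ∫⁻ x in Ω, ENNReal.ofReal (frobNorm (A + G j x) ^ p) ≤ ENNReal.ofReal C := by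
    intro p hp hpn
    obtain ⟨C, hC, h⟩ := exists_lintegral_rpow_le (volume.restrict Ω)
      (volume.real Ω * (M * (1 + frobNorm A ^ (2 * n)))) hp hpn
    refine ⟨C, hC, fun j => h _ (fun x => frobNorm_nonneg _) (hFint j).aemeasurable fun t ht => ?_⟩
    rw [Measure.restrict_apply' hΩm, inter_comm, mul_assoc, ENNReal.ofReal_mul hV.le, mul_comm]
    exact (hweak j t ht).trans_eq (by rw [measureReal_def, ENNReal.ofReal_toReal hΩfin])
  have hLp' : ∀ p : ℝ, 1 ≤ p → p < 2 * n → ∃ C : ℝ, ∀ j,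
      (∫ x in Ω, frobNorm (A + G j x) ^ p) ≤ C := by
    intro p hp hpn
    obtain ⟨C, hC, h⟩ := hLp p hp hpn
    refine ⟨C, fun j => (Real.le_norm_self _).trans ((norm_integral_le_lintegral_norm _).trans
      (ENNReal.toReal_le_of_le_ofReal hC (le_of_eq_of_le (lintegral_congr fun x => ?_) (h j))))⟩
    rw [Real.norm_eq_abs, abs_of_nonneg (Real.rpow_nonneg (frobNorm_nonneg _) _)]
  have hn1 : (1 : ℝ) ≤ n := by exact_mod_cast hn
  have hconv : ∀ g : ((Fin n ⊕ Fin n) → ℝ) → ℝ, Measurable g → (∃ C : ℝ, ∀ x, |g x| ≤ C) →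
      ∀ k i, Tendsto (fun j => ∫ x in Ω, (A + G j x) k i * g x) atTop
        (𝓝 (∫ x in Ω, A k i * g x)) := by
    obtain ⟨C, -, hC⟩ := hLp (3 / 2) (by norm_num) (by linarith)
    exact fun g hg hgb k i => tendsto_setIntegral_add_mul hΩo hΩb helim hpert A hC hg hgb k i
  have hmean : ∀ k i, Tendsto (fun j => ∫ x in Ω, (A + G j x) k i) atTop
      (𝓝 (volume.real Ω * A k i)) := fun k i => by
    simpa using hconv (fun _ => 1) measurable_const ⟨1, fun _ => by simp⟩ k i
  obtain ⟨C, hC⟩ := hLp' 1 le_rfl (by linarith)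
  simp only [Real.rpow_one] at hC
  rw [LSet, mem_union, not_or] at hAL
  refine ⟨fun j x => lmap A 0 x + v j x, fun j x => A + G j x, fun j =>
    ⟨(hpert j).hasWeakGradientOn hΩb A, (hpert j).memHolder hα hΩb.closure A, fun x hx => ?_⟩,
    hweak, fun s hs => ?_, ?_, hLp', hconv, ?_, ?_⟩
  · beta_reduce
    rw [(hpert j).eq_zero x fun h => (hΩo.frontier_eq ▸ hx).2 h, add_zero]
  · refine squeeze_zero_norm' (a := fun j => 2 * e j) ?_ (by simpa using helim.const_mul 2)
    filter_upwards [eventually_ge_atTop ⌈s⌉₊] with j hj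
    refine norm_setIntegral_one_add_rpow_le (fun x => frobNorm_nonneg _) (by linarith)
      ((Nat.ceil_le.1 hj).trans (by exact_mod_cast le_max_left j (2 * n))) (he0 j).le
      (fun x hx => ?_) (hB j)
    by_contra h
    exact hx.2 (hmem j x ⟨hx.1, h⟩)
  · simp only [add_sub_cancel_left]
    exact squeeze_zero (fun j => holderNorm_nonneg _ _ _)
      (fun j => (hpert j).holderNorm_le (he0 j).le _) (by simpa using helim.const_mul 2)
  · rw [L1set_eq] at hAL ⊢
    have := hAL.1
    simp only [mem_ofPred_eq, not_forall] at this
    obtain ⟨k, l, hkl, h0⟩ := this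
    exact liminf_integral_frobDist_pos hHint hC hkl (mul_ne_zero hV.ne' h0) (hmean k l)
  · rw [L2set_eq] at hAL ⊢
    have := hAL.2
    simp only [mem_ofPred_eq, not_forall] at this
    obtain ⟨k, l, hkl, h0⟩ := this
    exact liminf_integral_frobDist_pos hHint hC hkl (mul_ne_zero hV.ne' h0) (hmean k l)

end Paper
end
end

section
/- Let K ⊂ ℝ^{d×m}, let A ∉ K, and let (A_n, μ_n, γ_n) be staircase-laminate data for K with base A; set β_n := γ_1⋯γ_n (β_0 := 1) and ν^N := Σ_{n=1}^N β_{n−1}(1−γ_n)μ_n + β_N δ_{A_N}. Then: (i) each ν^N is a laminate of finite order with support contained in K ∪ {A_N} and barycenter A; (ii) for every Borel set E ⊂ ℝ^{d×m} the limit ν^∞(E) := lim_{N→∞} ν^N(E) exists; and (iii) ν^∞ is a probability measure supported in K which is a countable convex combination of Dirac masses. -/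
open MeasureTheory Set Filter Topology

noncomputable section

namespace Paper

variable {ι κ : Type*}

instance : MeasurableSpace (Matrix κ ι ℝ) :=
  inferInstanceAs (MeasurableSpace (κ → ι → ℝ))

/-- Laminates of finite order: the smallest family of (probability) measures on matrix space
containing Dirac masses and closed under elementary splitting. -/
inductive IsLaminate [Fintype ι] [Fintype κ] : Measure (Matrix κ ι ℝ) → Prop
  | dirac (A : Matrix κ ι ℝ) : IsLaminate (Measure.dirac A)
  | split (lam lam' : ℝ) (A B B' : Matrix κ ι ℝ) (ν' : Measure (Matrix κ ι ℝ))
      (hlam : lam ∈ Set.Ioc (0:ℝ) 1) (hlam' : lam' ∈ Set.Ioo (0:ℝ) 1)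
      (hprob : IsProbabilityMeasure ν') (hrank : (B' - B).rank = 1)
      (hA : A = lam' • B + (1 - lam') • B')
      (hν : IsLaminate (ENNReal.ofReal lam • Measure.dirac A + ENNReal.ofReal (1 - lam) • ν')) :
      IsLaminate (ENNReal.ofReal lam •
          (ENNReal.ofReal lam' • Measure.dirac B + ENNReal.ofReal (1 - lam') • Measure.dirac B')
        + ENNReal.ofReal (1 - lam) • ν')

/-- Barycenter (center of mass) of a measure on matrix space, defined entrywise. -/
def barycenter [Fintype ι] [Fintype κ] (ν : Measure (Matrix κ ι ℝ)) : Matrix κ ι ℝ :=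
  Matrix.of fun k i => ∫ X, X k i ∂ν

/-- Staircase-laminate data for `K` with base `A`. -/
structure StaircaseData [Fintype ι] [Fintype κ]
    (K : Set (Matrix κ ι ℝ)) (A : Matrix κ ι ℝ) : Type _ where
  Aseq : ℕ → Matrix κ ι ℝ
  μseq : ℕ → Measure (Matrix κ ι ℝ)
  γseq : ℕ → ℝ
  base : Aseq 0 = A
  notMem : ∀ n, Aseq n ∉ K
  prob : ∀ n, 1 ≤ n → IsProbabilityMeasure (μseq n)
  suppK : ∀ n, 1 ≤ n → μseq n Kᶜ = 0
  γmem : ∀ n, 1 ≤ n → γseq n ∈ Set.Ioo (0:ℝ) 1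
  mono : Monotone fun n => frobNorm (Aseq n)
  norm_tendsto : Tendsto (fun n => frobNorm (Aseq n)) atTop atTop
  beta_tendsto : Tendsto (fun n => ∏ k ∈ Finset.range n, γseq (k + 1)) atTop (nhds 0)
  laminate : ∀ n, 1 ≤ n →
    IsLaminate (ENNReal.ofReal (1 - γseq n) • μseq n
      + ENNReal.ofReal (γseq n) • Measure.dirac (Aseq n))
  bary : ∀ n, 1 ≤ n →
    barycenter (ENNReal.ofReal (1 - γseq n) • μseq n
      + ENNReal.ofReal (γseq n) • Measure.dirac (Aseq n)) = Aseq (n - 1)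

variable [Fintype ι] [Fintype κ]

/-- `β_n = γ_1 ⋯ γ_n`. -/
def beta {K : Set (Matrix κ ι ℝ)} {A : Matrix κ ι ℝ} (D : StaircaseData K A) (n : ℕ) : ℝ :=
  ∏ k ∈ Finset.range n, D.γseq (k + 1)

/-- The finite-stage laminates `ν^N`. -/
def nuN {K : Set (Matrix κ ι ℝ)} {A : Matrix κ ι ℝ} (D : StaircaseData K A) (N : ℕ) :
    Measure (Matrix κ ι ℝ) :=
  (∑ n ∈ Finset.range N, ENNReal.ofReal (beta D n * (1 - D.γseq (n + 1))) • D.μseq (n + 1))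
    + ENNReal.ofReal (beta D N) • Measure.dirac (D.Aseq N)

/-- The associated staircase laminate `ν^∞`. -/
def nuInf {K : Set (Matrix κ ι ℝ)} {A : Matrix κ ι ℝ} (D : StaircaseData K A) :
    Measure (Matrix κ ι ℝ) :=
  Measure.sum fun n => ENNReal.ofReal (beta D n * (1 - D.γseq (n + 1))) • D.μseq (n + 1)


instance [Finite ι] [Finite κ] : MeasurableSingletonClass (Matrix κ ι ℝ) :=
  inferInstanceAs (MeasurableSingletonClass (κ → ι → ℝ))

namespace IsLaminate

variable {ν : Measure (Matrix κ ι ℝ)}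

lemma isProbabilityMeasure (h : IsLaminate ν) : IsProbabilityMeasure ν := by
  induction h with
  | dirac A => infer_instance
  | split lam lam' A B B' ν' hlam hlam' hprob hrank hA hν ih =>
    constructor
    have h1 := ih.measure_univ
    rw [Measure.add_apply, Measure.smul_apply, measure_univ] at h1
    rw [Measure.add_apply, Measure.smul_apply, ← h1]
    congr 2
    simp [← ENNReal.ofReal_add hlam'.1.le (sub_nonneg.2 hlam'.2.le)]

lemma integrable_entry (h : IsLaminate ν) (k : κ) (i : ι) :
    Integrable (fun X : Matrix κ ι ℝ => X k i) ν := by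
  induction h with
  | dirac A => exact integrable_dirac (by simp)
  | split lam lam' A B B' ν' hlam hlam' hprob hrank hA hν ih =>
    rw [integrable_add_measure] at ih ⊢
    refine ⟨Integrable.smul_measure (integrable_add_measure.2 ⟨?_, ?_⟩) ENNReal.ofReal_ne_top, ih.2⟩ <;>
    exact (integrable_dirac (by simp)).smul_measure ENNReal.ofReal_ne_top

lemma exists_finite_support (h : IsLaminate ν) : ∃ s : Set (Matrix κ ι ℝ), s.Finite ∧ ν sᶜ = 0 := by
  induction h with
  | dirac A => exact ⟨{A}, finite_singleton A, by simp⟩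
  | split lam lam' A B B' ν' hlam hlam' hprob hrank hA hν ih =>
    obtain ⟨s, hs, h0⟩ := ih
    refine ⟨s ∪ {B, B'}, hs.union (by simp), ?_⟩
    have hsub : (s ∪ {B, B'})ᶜ ⊆ sᶜ := compl_subset_compl.2 subset_union_left
    have h1 := measure_mono_null hsub h0
    rw [Measure.add_apply, add_eq_zero] at h1 ⊢
    refine ⟨?_, h1.2⟩
    simp

/-- Elementary splitting with an unnormalised remainder `σ`. -/
lemma split_of_mass {t lam' : ℝ} {A B B' : Matrix κ ι ℝ} {σ : Measure (Matrix κ ι ℝ)}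
    (ht : t ∈ Set.Ioc (0 : ℝ) 1) (hlam' : lam' ∈ Set.Ioo (0 : ℝ) 1)
    (hσ : σ univ = ENNReal.ofReal (1 - t)) (hrank : (B' - B).rank = 1)
    (hA : A = lam' • B + (1 - lam') • B')
    (h : IsLaminate (ENNReal.ofReal t • Measure.dirac A + σ)) :
    IsLaminate (ENNReal.ofReal t •
      (ENNReal.ofReal lam' • Measure.dirac B + ENNReal.ofReal (1 - lam') • Measure.dirac B') + σ) := by
  obtain ⟨ν', hν', rfl⟩ : ∃ ν' : Measure (Matrix κ ι ℝ), IsProbabilityMeasure ν' ∧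
      σ = ENNReal.ofReal (1 - t) • ν' := by
    rcases ht.2.eq_or_lt with rfl | hlt
    · refine ⟨Measure.dirac A, inferInstance, ?_⟩
      simpa using hσ
    · have h0 : ENNReal.ofReal (1 - t) ≠ 0 := by simpa using hlt
      refine ⟨(ENNReal.ofReal (1 - t))⁻¹ • σ, ⟨?_⟩, ?_⟩
      · rw [Measure.smul_apply, hσ, smul_eq_mul, ENNReal.inv_mul_cancel h0 ENNReal.ofReal_ne_top]
      · rw [smul_smul, ENNReal.mul_inv_cancel h0 ENNReal.ofReal_ne_top, one_smul]
  exact .split t lam' A B B' ν' ht hlam' hν' hrank hA h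

lemma barycenter_dirac (A : Matrix κ ι ℝ) : barycenter (Measure.dirac A) = A := by
  ext k i
  simp [barycenter]

lemma barycenter_split {lam lam' : ℝ} {A B B' : Matrix κ ι ℝ} {ν' : Measure (Matrix κ ι ℝ)}
    (hlam' : lam' ∈ Set.Ioo (0 : ℝ) 1) (hA : A = lam' • B + (1 - lam') • B')
    (hν : IsLaminate (ENNReal.ofReal lam • Measure.dirac A + ENNReal.ofReal (1 - lam) • ν')) :
    barycenter (ENNReal.ofReal lam •
        (ENNReal.ofReal lam' • Measure.dirac B + ENNReal.ofReal (1 - lam') • Measure.dirac B')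
      + ENNReal.ofReal (1 - lam) • ν') =
    barycenter (ENNReal.ofReal lam • Measure.dirac A + ENNReal.ofReal (1 - lam) • ν') := by
  ext k i
  obtain ⟨h1, h2⟩ := integrable_add_measure.1 (hν.integrable_entry k i)
  have hd (C : Matrix κ ι ℝ) (r : ℝ) :
      Integrable (fun X : Matrix κ ι ℝ => X k i) (ENNReal.ofReal r • Measure.dirac C) :=
    (integrable_dirac (by simp)).smul_measure ENNReal.ofReal_ne_top
  simp only [barycenter, Matrix.of_apply]
  rw [integral_add_measure h1 h2, integral_add_measure
    ((integrable_add_measure.2 ⟨hd _ _, hd _ _⟩).smul_measure ENNReal.ofReal_ne_top) h2,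
    integral_smul_measure, integral_smul_measure, integral_add_measure (hd _ _) (hd _ _)]
  simp [integral_smul_measure, hA, ENNReal.toReal_ofReal hlam'.1.le,
    ENNReal.toReal_ofReal (sub_nonneg.2 hlam'.2.le)]

/-- An atom of a laminate may be replaced by any laminate whose barycenter is that atom. -/
lemma replace_atom {ω σ : Measure (Matrix κ ι ℝ)} {t : ℝ} (hω : IsLaminate ω)
    (ht : t ∈ Set.Ioc (0 : ℝ) 1) (hσ : σ univ = ENNReal.ofReal (1 - t))
    (h : IsLaminate (ENNReal.ofReal t • Measure.dirac (barycenter ω) + σ)) :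
    IsLaminate (ENNReal.ofReal t • ω + σ) := by
  induction hω with
  | dirac A => rwa [barycenter_dirac] at h
  | split lam lam' A B B' ν' hlam hlam' hprob hrank hA hν ih =>
    rw [barycenter_split hlam' hA hν] at h
    have key := ih h
    have hreassoc (θ : Measure (Matrix κ ι ℝ)) :
        ENNReal.ofReal t • (ENNReal.ofReal lam • θ + ENNReal.ofReal (1 - lam) • ν') + σ =
        ENNReal.ofReal (t * lam) • θ + (ENNReal.ofReal (t * (1 - lam)) • ν' + σ) := by
      rw [smul_add, smul_smul, smul_smul, ENNReal.ofReal_mul ht.1.le, ENNReal.ofReal_mul ht.1.le,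
        add_assoc]
    rw [hreassoc] at key ⊢
    refine split_of_mass ⟨mul_pos ht.1 hlam.1, mul_le_one₀ ht.2 hlam.1.le hlam.2⟩ hlam' ?_
      hrank hA key
    simp only [Measure.add_apply, Measure.smul_apply, measure_univ, smul_eq_mul, mul_one, hσ]
    rw [← ENNReal.ofReal_add (mul_nonneg ht.1.le (sub_nonneg.2 hlam.2)) (sub_nonneg.2 ht.2)]
    congr 1
    ring

lemma barycenter_replace_atom {ω σ : Measure (Matrix κ ι ℝ)} {t : ℝ} (hω : IsLaminate ω)
    (h : IsLaminate (ENNReal.ofReal t • Measure.dirac (barycenter ω) + σ)) :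
    barycenter (ENNReal.ofReal t • ω + σ) =
      barycenter (ENNReal.ofReal t • Measure.dirac (barycenter ω) + σ) := by
  ext k i
  obtain ⟨h1, h2⟩ := integrable_add_measure.1 (h.integrable_entry k i)
  have h3 := (hω.integrable_entry k i).smul_measure (c := ENNReal.ofReal t) ENNReal.ofReal_ne_top
  simp only [barycenter, Matrix.of_apply] at h1 ⊢
  rw [integral_add_measure h1 h2, integral_add_measure h3 h2, integral_smul_measure,
    integral_smul_measure, integral_dirac, Matrix.of_apply]

end IsLaminate

/-- A measure carried by a countable set is a countable sum of weighted Dirac masses. -/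
lemma exists_eq_sum_smul_dirac {α : Type*} [MeasurableSpace α] [MeasurableSingletonClass α]
    [Inhabited α] {ν : Measure α} {S : Set α} (hS : S.Countable) (h : ν Sᶜ = 0) :
    ∃ (a : ℕ → α) (c : ℕ → ENNReal), ν = Measure.sum fun n => c n • Measure.dirac (a n) := by
  obtain ⟨g, hg⟩ := hS.to_subtype.exists_injective_nat
  refine ⟨Function.extend g Subtype.val default,
    Function.extend g (fun s => ν {(s : α)}) 0, Measure.ext fun E hE => ?_⟩
  have hsum : (fun n => Function.extend g (fun s => ν {(s : α)}) 0 n *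
      Measure.dirac (Function.extend g Subtype.val default n) E) =
      Function.extend g (fun s : S => ν {(s : α)} * E.indicator 1 (s : α)) 0 := by
    funext n
    by_cases hn : ∃ s, g s = n
    · obtain ⟨s, rfl⟩ := hn
      simp [hg.extend_apply]
    · simp [Function.extend_apply' _ _ _ hn]
  rw [Measure.sum_apply _ hE]
  simp only [Measure.smul_apply, smul_eq_mul]
  rw [hsum, tsum_extend_zero hg]
  calc ν E = ν (E ∩ S) := (measure_inter_conull' (measure_mono_null (by
        intro x hx; exact hx.2) h)).symm
    _ = ∑' s : S, ν (E ∩ {(s : α)}) := by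
        have := hS.to_subtype
        rw [← measure_iUnion]
        · congr 1
          ext x
          simp
        · intro s t hst
          refine Disjoint.mono inter_subset_right inter_subset_right ?_
          simpa [Subtype.val_inj] using hst
        · exact fun s => hE.inter (measurableSet_singleton _)
    _ = _ := by
        refine tsum_congr fun s => ?_
        by_cases hs : (s : α) ∈ E
        · simp [hs, inter_eq_right.2 (singleton_subset_iff.2 hs)]
        · simp [hs]

section Staircase

variable {K : Set (Matrix κ ι ℝ)} {A : Matrix κ ι ℝ} (D : StaircaseData K A)

lemma beta_zero : beta D 0 = 1 := by simp [beta]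

lemma beta_succ (n : ℕ) : beta D (n + 1) = beta D n * D.γseq (n + 1) :=
  Finset.prod_range_succ _ _

lemma beta_pos (n : ℕ) : 0 < beta D n :=
  Finset.prod_pos fun k _ => (D.γmem (k + 1) k.succ_pos).1

lemma beta_le_one (n : ℕ) : beta D n ≤ 1 :=
  Finset.prod_le_one (fun k _ => (D.γmem (k + 1) k.succ_pos).1.le)
    fun k _ => (D.γmem (k + 1) k.succ_pos).2.le

/-- The part of `nuN D N` carried by `K`. -/
def stairs (N : ℕ) : Measure (Matrix κ ι ℝ) :=
  ∑ n ∈ Finset.range N, ENNReal.ofReal (beta D n * (1 - D.γseq (n + 1))) • D.μseq (n + 1)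

lemma nuN_eq (N : ℕ) :
    nuN D N = ENNReal.ofReal (beta D N) • Measure.dirac (D.Aseq N) + stairs D N :=
  add_comm _ _

lemma nuN_succ (N : ℕ) :
    nuN D (N + 1) = ENNReal.ofReal (beta D N) •
      (ENNReal.ofReal (1 - D.γseq (N + 1)) • D.μseq (N + 1)
        + ENNReal.ofReal (D.γseq (N + 1)) • Measure.dirac (D.Aseq (N + 1))) + stairs D N := by
  rw [nuN, Finset.sum_range_succ, beta_succ, smul_add, smul_smul, smul_smul,
    ENNReal.ofReal_mul (beta_pos D N).le, ENNReal.ofReal_mul (beta_pos D N).le, stairs]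
  abel

lemma stairs_univ (N : ℕ) : stairs D N univ = ENNReal.ofReal (1 - beta D N) := by
  induction N with
  | zero => simp [stairs, beta_zero]
  | succ N ih =>
    have := D.prob (N + 1) N.succ_pos
    have hγ := D.γmem (N + 1) N.succ_pos
    rw [stairs, Finset.sum_range_succ, ← stairs, Measure.add_apply, ih, Measure.smul_apply,
      measure_univ, smul_eq_mul, mul_one, ← ENNReal.ofReal_add
        (sub_nonneg.2 (beta_le_one D N))
        (mul_nonneg (beta_pos D N).le (sub_nonneg.2 hγ.2.le)), beta_succ]
    congr 1
    ring

lemma stairs_compl (N : ℕ) : stairs D N Kᶜ = 0 := by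
  simp [stairs, Measure.finsetSum_apply, D.suppK]

lemma isLaminate_nuN (N : ℕ) : IsLaminate (nuN D N) ∧ barycenter (nuN D N) = A := by
  induction N with
  | zero =>
    have h : nuN D 0 = Measure.dirac A := by simp [nuN, beta_zero, D.base]
    rw [h]
    exact ⟨.dirac A, IsLaminate.barycenter_dirac A⟩
  | succ N ih =>
    have hb := D.bary (N + 1) N.succ_pos
    have hl := D.laminate (N + 1) N.succ_pos
    rw [Nat.add_sub_cancel] at hb
    rw [nuN_eq, ← hb] at ih
    rw [nuN_succ]
    exact ⟨hl.replace_atom ⟨beta_pos D N, beta_le_one D N⟩ (stairs_univ D N) ih.1,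
      (hl.barycenter_replace_atom ih.1).trans ih.2⟩

lemma nuN_compl (N : ℕ) : nuN D N (K ∪ {D.Aseq N})ᶜ = 0 := by
  rw [nuN_eq, Measure.add_apply, add_eq_zero]
  refine ⟨?_, measure_mono_null (compl_subset_compl.2 subset_union_left) (stairs_compl D N)⟩
  refine measure_mono_null (compl_subset_compl.2 subset_union_right) ?_
  simp

lemma tendsto_nuN {E : Set (Matrix κ ι ℝ)} (hE : MeasurableSet E) :
    Tendsto (fun N => nuN D N E) atTop (𝓝 (nuInf D E)) := by
  have h1 : Tendsto (fun N => stairs D N E) atTop (𝓝 (nuInf D E)) := by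
    simp only [stairs, nuInf, Measure.finsetSum_apply, Measure.sum_apply _ hE]
    exact ENNReal.tendsto_nat_tsum _
  have h2 : Tendsto (fun N => ENNReal.ofReal (beta D N)) atTop (𝓝 0) := by
    simpa [beta] using ENNReal.tendsto_ofReal D.beta_tendsto
  have h3 : Tendsto (fun N => ENNReal.ofReal (beta D N) * Measure.dirac (D.Aseq N) E)
      atTop (𝓝 0) :=
    tendsto_of_tendsto_of_tendsto_of_le_of_le tendsto_const_nhds h2 (fun _ => zero_le)
      fun N => mul_le_of_le_one_right' prob_le_one
  simpa [nuN_eq] using h3.add h1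

lemma isProbabilityMeasure_nuInf : IsProbabilityMeasure (nuInf D) := by
  refine ⟨tendsto_nhds_unique (tendsto_nuN D MeasurableSet.univ) ?_⟩
  have h (N : ℕ) : nuN D N univ = 1 := (isLaminate_nuN D N).1.isProbabilityMeasure.measure_univ
  simp [h]

lemma nuInf_compl : nuInf D Kᶜ = 0 := by
  rw [nuInf, Measure.sum_apply_eq_zero]
  intro n
  simp [D.suppK]

lemma exists_countable_nuInf_compl :
    ∃ S : Set (Matrix κ ι ℝ), S.Countable ∧ nuInf D Sᶜ = 0 := by
  have h (n : ℕ) : ∃ s : Set (Matrix κ ι ℝ), s.Finite ∧ D.μseq (n + 1) sᶜ = 0 := by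
    obtain ⟨s, hs, h0⟩ := (D.laminate (n + 1) n.succ_pos).exists_finite_support
    have hγ := (D.γmem (n + 1) n.succ_pos).2
    refine ⟨s, hs, ?_⟩
    rw [Measure.add_apply, add_eq_zero] at h0
    simpa [not_le.2 hγ] using h0.1
  choose s hs h0 using h
  refine ⟨⋃ n, s n, countable_iUnion fun n => (hs n).countable, ?_⟩
  rw [nuInf, Measure.sum_apply_eq_zero]
  intro n
  rw [Measure.smul_apply,
    measure_mono_null (compl_subset_compl.2 (subset_iUnion s n)) (h0 n), smul_zero]

end Staircase

/-- Proposition (construction of staircase laminates): the finite stages `ν^N` are laminates of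
finite order supported in `K ∪ {A_N}` with barycenter `A`, the limit `ν^∞(E) = lim_N ν^N(E)`
exists, and defines a probability measure supported in `K` which is a countable sum of Diracs. -/
theorem staircase_laminate_construction {d m : ℕ}
    (K : Set (Matrix (Fin d) (Fin m) ℝ)) (A : Matrix (Fin d) (Fin m) ℝ) (hA : A ∉ K)
    (D : StaircaseData K A) :
    (∀ N : ℕ, IsLaminate (nuN D N) ∧ (nuN D N) ((K ∪ {D.Aseq N})ᶜ) = 0 ∧
      barycenter (nuN D N) = A) ∧
    (∀ E : Set (Matrix (Fin d) (Fin m) ℝ), MeasurableSet E →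
      Tendsto (fun N => nuN D N E) atTop (nhds (nuInf D E))) ∧
    IsProbabilityMeasure (nuInf D) ∧ (nuInf D) Kᶜ = 0 ∧
    ∃ (a : ℕ → Matrix (Fin d) (Fin m) ℝ) (c : ℕ → ENNReal),
      nuInf D = Measure.sum (fun n => c n • Measure.dirac (a n)) := by
  obtain ⟨S, hS, h0⟩ := exists_countable_nuInf_compl D
  have : Inhabited (Matrix (Fin d) (Fin m) ℝ) := ⟨A⟩
  exact ⟨fun N => ⟨(isLaminate_nuN D N).1, nuN_compl D N, (isLaminate_nuN D N).2⟩,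
    fun E hE => tendsto_nuN D hE, isProbabilityMeasure_nuInf D, nuInf_compl D,
    exists_eq_sum_smul_dirac hS h0⟩

end Paper
end
end
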